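/- arXiv:1503.08791 — 2 statements merged into one kernel-verified Lean document; each statement's English description precedes it below -/
import Mathlib

section
/- Fix an integer t ≥ 2 and r ≥ 1. The meromorphic function H(q,1,1,1) = a(q,1,1,1)/(1 − b(q,1,1,1)) (the generating function of canonical t-ary forests with r roots by number of internal vertices) has exactly one singularity q = q_0 in the disc |q| < 1 − 0.72/t; this singularity is a simple pole, is positive, and does not depend on r. For t ≥ 4 one has |q_0 − (1/2 + 2^{−(t+3)} + (t+4)·2^{−(2t+5)} + (3t²+23t+38)·2^{−(3t+8)})| ≤ (7t³/100)·2^{−4t}. Furthermore, setting Q = 1/2 + (log 2)/(2t) + 0.06/t² for t ≥ 6, q_0 is the only singularity q of H(q,1,1,1) with |q| ≤ q_0/Q. -/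
open scoped BigOperators
open Filter MeasureTheory

noncomputable section

/-- `hp t j = 1 + t + ⋯ + t^(j-1) = (t^j - 1)/(t-1)`. -/
def hp (t j : ℕ) : ℕ := ∑ i ∈ Finset.range j, t ^ i

/-- The series `b(q,u,v,w)`
`b = Σ_{j≥1} v q^{h_j} u^{t^j} w^j/(1−q^{h_j} u^{t^j}) ∏_{i=1}^{j−1} (1−v−q^{h_i}u^{t^i})/(1−q^{h_i}u^{t^i})`. -/
def bGF (t : ℕ) (q u v w : ℂ) : ℂ :=
  ∑' j : ℕ,
    v * q ^ hp t (j + 1) * u ^ t ^ (j + 1) * w ^ (j + 1) /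
        (1 - q ^ hp t (j + 1) * u ^ t ^ (j + 1)) *
      ∏ i ∈ Finset.Icc 1 j,
        (1 - v - q ^ hp t i * u ^ t ^ i) / (1 - q ^ hp t i * u ^ t ^ i)

/-- The series `a(q,u,v,w)` (for canonical forests with `r` roots)
`a = Σ_{j≥0} v q^{r h_j} u^{r t^j} w^j ∏_{i=1}^{j} (1−v−q^{h_i}u^{t^i})/(1−q^{h_i}u^{t^i})`. -/
def aGF (t r : ℕ) (q u v w : ℂ) : ℂ :=
  ∑' j : ℕ,
    v * q ^ (r * hp t j) * u ^ (r * t ^ j) * w ^ j *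
      ∏ i ∈ Finset.Icc 1 j,
        (1 - v - q ^ hp t i * u ^ t ^ i) / (1 - q ^ hp t i * u ^ t ^ i)

/-- A canonical `t`-ary forest with `r` (ordered) roots, encoded by its sequence of
numbers of internal vertices on each level (a canonical forest is uniquely determined
by this sequence: on each level the leaves come first, since outdegrees read from left
to right are non-decreasing).  The number `c_0` of internal vertices on level `0` is at
most `r`, each level's internal-vertex count satisfies `1 ≤ c_{k+1} ≤ t·c_k`, and the
list stops at the last level containing internal vertices. -/
structure CanonicalForest (t r : ℕ) where
  levels : List ℕ
  pos : ∀ c ∈ levels, 0 < c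
  head_le : ∀ c ∈ levels.head?, c ≤ r
  chain : levels.Chain' fun a b => b ≤ t * a

namespace CanonicalForest

variable {t r : ℕ} (T : CanonicalForest t r)

/-- the number `n(T)` of internal vertices -/
def size : ℕ := T.levels.sum

/-- the height `h(T)`: the maximal distance of a leaf from the root level -/
def height : ℕ := T.levels.length

/-- the number of internal vertices at depth `k` -/
def internAt (k : ℕ) : ℕ := T.levels.getD k 0

/-- the number of vertices at depth `k` -/
def vertsAt (k : ℕ) : ℕ := if k = 0 then r else t * T.internAt (k - 1)

/-- the number of leaves at depth `k` -/
def leavesAt (k : ℕ) : ℕ := T.vertsAt k - T.internAt k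

/-- the number `m(T)` of leaves at maximal depth -/
def lastLeaves : ℕ := T.vertsAt T.height

/-- the number `d(T)` of distinct depths at which leaves occur -/
def distinctDepths : ℕ :=
  ((Finset.range (T.height + 1)).filter fun k => 0 < T.leavesAt k).card

/-- the (leaf-)width `w(T)`: the maximal number of leaves on one level -/
def width : ℕ := (Finset.range (T.height + 1)).sup fun k => T.leavesAt k

/-- the total path length `ℓ(T)`: the sum of the depths of all vertices -/
def pathLength : ℕ := ∑ k ∈ Finset.range (T.height + 1), k * T.vertsAt k

end CanonicalForest

/-- the number of canonical `t`-ary forests with `r` roots and `n` internal vertices -/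
def forestCount (t r n : ℕ) : ℕ := Nat.card {T : CanonicalForest t r // T.size = n}

/-- the probability of an event under the uniform distribution on canonical `t`-ary
forests with `r` roots and `n` internal vertices -/
def forestProb (t r n : ℕ) (s : Set (CanonicalForest t r)) : ℝ :=
  (Nat.card {T : CanonicalForest t r // T.size = n ∧ T ∈ s} : ℝ) / forestCount t r n

/-- the expectation of a random variable under the uniform distribution on canonical
`t`-ary forests with `r` roots and `n` internal vertices -/
def forestExp (t r n : ℕ) (f : CanonicalForest t r → ℝ) : ℝ :=
  (∑ᶠ T : {T : CanonicalForest t r // T.size = n}, f T.1) / forestCount t r n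

/-- the variance of a random variable under the uniform distribution on canonical
`t`-ary forests with `r` roots and `n` internal vertices -/
def forestVar (t r n : ℕ) (f : CanonicalForest t r → ℝ) : ℝ :=
  forestExp t r n (fun T => f T ^ 2) - forestExp t r n f ^ 2

/-- the distribution function of the standard normal distribution -/
def stdGaussCDF (x : ℝ) : ℝ :=
  (Real.sqrt (2 * Real.pi))⁻¹ * ∫ u in Set.Iic x, Real.exp (-u ^ 2 / 2)

/-- the density of the standard normal distribution -/
def stdGaussPDF (x : ℝ) : ℝ :=
  (Real.sqrt (2 * Real.pi))⁻¹ * Real.exp (-x ^ 2 / 2)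


theorem moebius_norm_lt {a z : ℂ} (ha : ‖a‖ < 1) (hz : ‖z‖ < 1) :
    1 - (starRingEnd ℂ) a * z ≠ 0 ∧ ‖(z - a) / (1 - (starRingEnd ℂ) a * z)‖ < 1 := by
  have h1 : ‖(starRingEnd ℂ) a * z‖ < 1 := by
    rw [norm_mul, RCLike.norm_conj]
    nlinarith [norm_nonneg a, norm_nonneg z]
  have hne : 1 - (starRingEnd ℂ) a * z ≠ 0 := by
    intro h
    have : (starRingEnd ℂ) a * z = 1 := by linear_combination -h
    rw [this] at h1
    simp at h1
  refine ⟨hne, ?_⟩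
  rw [norm_div, div_lt_one (norm_pos_iff.mpr hne)]
  have hpos := norm_nonneg (1 - (starRingEnd ℂ) a * z)
  refine lt_of_pow_lt_pow_left₀ 2 hpos ?_
  rw [← Complex.normSq_eq_norm_sq, ← Complex.normSq_eq_norm_sq]
  have ha2 : Complex.normSq a < 1 := by
    rw [Complex.normSq_eq_norm_sq]; nlinarith [norm_nonneg a]
  have hz2 : Complex.normSq z < 1 := by
    rw [Complex.normSq_eq_norm_sq]; nlinarith [norm_nonneg z]
  simp only [Complex.normSq_apply, Complex.sub_re, Complex.sub_im, Complex.mul_re, Complex.mul_im,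
    Complex.conj_re, Complex.conj_im, Complex.one_re, Complex.one_im] at *
  nlinarith [mul_pos (sub_pos.mpr ha2) (sub_pos.mpr hz2)]

theorem unit_fix {f : ℂ → ℂ} {R' : ℝ} (hR' : R' < 1)
    (hd : DifferentiableOn ℂ f (Metric.ball 0 1))
    (hf : ∀ z, ‖z‖ < 1 → ‖f z‖ ≤ R') {a : ℂ} (ha : ‖a‖ < 1) (hfa : f a = a) :
    (∀ b, ‖b‖ < 1 → f b = b → b = a) ∧ deriv f a ≠ 1 := by
  set ca := (starRingEnd ℂ) a with hca
  have hna : ‖-a‖ < 1 := by simpa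
  -- the Moebius maps
  set ψ : ℂ → ℂ := fun z => (z - a) / (1 - ca * z) with hψ
  set χ : ℂ → ℂ := fun w => (w + a) / (1 + ca * w) with hχ
  have hψ1 : ∀ z, ‖z‖ < 1 → 1 - ca * z ≠ 0 ∧ ‖ψ z‖ < 1 := fun z hz => moebius_norm_lt ha hz
  have hχ1 : ∀ z, ‖z‖ < 1 → 1 + ca * z ≠ 0 ∧ ‖χ z‖ < 1 := by
    intro z hz
    have := moebius_norm_lt hna hz
    simpa [hχ, hca] using this
  have haa : 1 - ca * a ≠ 0 := (hψ1 a ha).1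
  have hχψ : ∀ z, ‖z‖ < 1 → χ (ψ z) = z := by
    intro z hz
    have h1 := (hψ1 z hz).1
    have h2 := (hχ1 (ψ z) (hψ1 z hz).2).1
    simp only [hχ]
    rw [div_eq_iff h2]
    simp only [hψ]
    have hu := inv_mul_cancel₀ h1
    rw [div_eq_mul_inv]
    linear_combination (z - a) * hu
  -- strictness
  obtain ⟨c, hc1, hc⟩ : ∃ c : ℝ, c < 1 ∧ ∀ z, ‖z‖ ≤ R' → ‖ψ z‖ ≤ c := by
    have hcont : ContinuousOn (fun z => ‖ψ z‖) (Metric.closedBall 0 R') := by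
      apply ContinuousOn.norm
      apply ContinuousOn.div (by fun_prop) (by fun_prop)
      intro z hz
      exact (hψ1 z (lt_of_le_of_lt (by simpa using hz) hR')).1
    have hR0 : 0 ≤ R' := (norm_nonneg _).trans (hf a ha)
    obtain ⟨m, hm, hmax⟩ := (isCompact_closedBall (0:ℂ) R').exists_isMaxOn
      ⟨0, by simpa using hR0⟩ hcont
    refine ⟨‖ψ m‖, (hψ1 m (lt_of_le_of_lt (by simpa using hm) hR')).2, fun z hz => ?_⟩
    exact hmax (by simpa using hz)
  set F : ℂ → ℂ := fun w => ψ (f (χ w)) with hF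
  have hχd : ∀ w, ‖w‖ < 1 → DifferentiableAt ℂ χ w := by
    intro w hw
    exact DifferentiableAt.fun_div (c := fun w => w + a) (d := fun w => 1 + ca * w) (by fun_prop) (by fun_prop) (hχ1 w hw).1
  have hψd : ∀ w, ‖w‖ < 1 → DifferentiableAt ℂ ψ w := by
    intro w hw
    exact DifferentiableAt.fun_div (c := fun w => w - a) (d := fun w => 1 - ca * w) (by fun_prop) (by fun_prop) (hψ1 w hw).1
  have hfd : ∀ w, ‖w‖ < 1 → DifferentiableAt ℂ f w := by
    intro w hw
    exact hd.differentiableAt (Metric.isOpen_ball.mem_nhds (by simpa using hw))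
  have hFd : DifferentiableOn ℂ F (Metric.ball 0 1) := by
    intro w hw
    have hw' : ‖w‖ < 1 := by simpa using hw
    have h1 := (hχ1 w hw').2
    have h2 := lt_of_le_of_lt (hf _ h1) hR'
    exact (DifferentiableAt.comp w (hψd _ h2) (DifferentiableAt.comp w (hfd _ h1) (hχd w hw'))).differentiableWithinAt
  have hχ0 : χ 0 = a := by simp [hχ]
  have hψa : ψ a = 0 := by simp [hψ]
  have hF0 : F 0 = 0 := by simp only [hF]; rw [hχ0, hfa, hψa]
  have hmaps : Set.MapsTo F (Metric.ball 0 1) (Metric.closedBall (F 0) c) := by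
    intro w hw
    have hw' : ‖w‖ < 1 := by simpa using hw
    rw [hF0]
    simpa using hc _ (hf _ (hχ1 w hw').2)
  constructor
  · intro b hb hfb
    have hwb := (hψ1 b hb).2
    have key := Complex.dist_le_div_mul_dist_of_mapsTo_ball hFd hmaps (z := ψ b) (by simpa using hwb)
    have hFb : F (ψ b) = ψ b := by simp only [hF]; rw [hχψ b hb, hfb]
    rw [hFb, hF0, dist_zero_right, div_one] at key
    have : ‖ψ b‖ = 0 := by nlinarith [norm_nonneg (ψ b)]
    have h0 : ψ b = 0 := norm_eq_zero.mp this
    simp only [hψ, div_eq_zero_iff] at h0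
    rcases h0 with h0 | h0
    · linear_combination h0
    · exact absurd h0 (hψ1 b hb).1
  · intro hder
    have key := Complex.norm_deriv_le_div_of_mapsTo_ball hFd hmaps (by norm_num)
    have hf1 : HasDerivAt f 1 a := hder ▸ (hfd a ha).hasDerivAt
    have hχ' : HasDerivAt χ (1 - ca * a) 0 := by
      have := ((hasDerivAt_id' (0:ℂ)).add_const a).fun_div
        (((hasDerivAt_id' (0:ℂ)).const_mul ca).const_add 1) (by simp)
      have e : (1 * (1 + ca * 0) - (0 + a) * (ca * 1)) / (1 + ca * 0) ^ 2 = 1 - ca * a := by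
        simp; ring
      rw [e] at this
      exact this
    have hψ' : HasDerivAt ψ (1 / (1 - ca * a)) a := by
      have := ((hasDerivAt_id' (a:ℂ)).sub_const a).fun_div
        (((hasDerivAt_id' (a:ℂ)).const_mul ca).const_sub 1) (by simpa using haa)
      have e : (1 * (1 - ca * a) - (a - a) * -(ca * 1)) / (1 - ca * a) ^ 2 = 1 / (1 - ca * a) := by
        rw [div_eq_div_iff (pow_ne_zero 2 haa) haa]
        ring
      rw [e] at this
      exact this
    have h1 : HasDerivAt (fun w => f (χ w)) (1 * (1 - ca * a)) 0 :=
      HasDerivAt.comp (h₂ := f) 0 (by rw [hχ0]; exact hf1) hχ'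
    have h2 : HasDerivAt F (1 / (1 - ca * a) * (1 * (1 - ca * a))) 0 :=
      HasDerivAt.comp (h₂ := ψ) 0 (by rw [hχ0, hfa]; exact hψ') h1
    rw [h2.deriv] at key
    have : 1 / (1 - ca * a) * (1 * (1 - ca * a)) = 1 := by field_simp
    rw [this] at key
    simp at key
    linarith

theorem ball_fix {f : ℂ → ℂ} {R R' : ℝ} (hR : 0 < R) (hR' : R' < R)
    (hd : DifferentiableOn ℂ f (Metric.ball 0 R))
    (hf : ∀ z, ‖z‖ < R → ‖f z‖ ≤ R') {a : ℂ} (ha : ‖a‖ < R) (hfa : f a = a) :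
    (∀ b, ‖b‖ < R → f b = b → b = a) ∧ deriv f a ≠ 1 := by
  have hRc : (R : ℂ) ≠ 0 := by exact_mod_cast hR.ne'
  have hsc : ∀ w : ℂ, ‖w‖ < 1 → ‖(R:ℂ) * w‖ < R := by
    intro w hw
    rw [norm_mul, Complex.norm_real, Real.norm_of_nonneg hR.le]
    nlinarith
  have hsd : ∀ w : ℂ, ‖w‖ < R → ‖w / (R:ℂ)‖ < 1 := by
    intro w hw
    rw [norm_div, Complex.norm_real, Real.norm_of_nonneg hR.le, div_lt_one hR]
    exact hw
  set g : ℂ → ℂ := fun w => f (R * w) / R with hg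
  have hfd : ∀ w, ‖w‖ < R → DifferentiableAt ℂ f w := by
    intro w hw
    exact hd.differentiableAt (Metric.isOpen_ball.mem_nhds (by simpa using hw))
  have hsc' : ∀ w : ℂ, HasDerivAt (fun w : ℂ => (R:ℂ) * w) R w := by
    intro w
    simpa using (hasDerivAt_id w).const_mul (R:ℂ)
  have hgd' : ∀ w : ℂ, ‖w‖ < 1 → HasDerivAt g (deriv f (R * w)) w := by
    intro w hw
    have := (HasDerivAt.comp (h₂ := f) w (hfd _ (hsc w hw)).hasDerivAt (hsc' w)).div_const (R:ℂ)
    rw [mul_div_assoc, div_self hRc, mul_one] at this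
    exact this
  have hgd : DifferentiableOn ℂ g (Metric.ball 0 1) := fun w hw =>
    (hgd' w (by simpa using hw)).differentiableAt.differentiableWithinAt
  have hcan : ∀ w : ℂ, (R:ℂ) * (w / R) = w := fun w => by field_simp
  have hga : g (a / R) = a / R := by simp only [hg]; rw [hcan, hfa]
  have key := unit_fix (f := g) (R' := R' / R) (by rw [div_lt_one hR]; exact hR') hgd
    (by
      intro z hz
      simp only [hg]
      rw [norm_div, Complex.norm_real, Real.norm_of_nonneg hR.le]
      gcongr
      exact hf _ (hsc z hz)) (hsd a ha) hga
  constructor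
  · intro b hb hfb
    have := key.1 (b / R) (hsd b hb) (by simp only [hg]; rw [hcan, hfb])
    field_simp at this
    exact this
  · have := key.2
    rw [(hgd' _ (hsd a ha)).deriv, hcan] at this
    exact this


/-- `x_n(q) = q^{h_n}/(1-q^{h_n})`. -/
def xx {K : Type*} [NormedField K] (t n : ℕ) (q : K) : K := q ^ hp t n / (1 - q ^ hp t n)

/-- `T_n(q) = 1 - x_n + x_n x_{n+1} - ...`. -/
def TT {K : Type*} [NormedField K] (t n : ℕ) (q : K) : K :=
  ∑' j : ℕ, (-1) ^ j * ∏ i ∈ Finset.range j, xx t (n + i) q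

theorem hp_mono (t : ℕ) {m n : ℕ} (h : m ≤ n) : hp t m ≤ hp t n := by
  unfold hp
  exact Finset.sum_le_sum_of_subset (by simpa using h)

theorem hp_one (t : ℕ) : hp t 1 = 1 := by simp [hp]
theorem hp_two (t : ℕ) : hp t 2 = t + 1 := by simp [hp, Finset.sum_range_succ]; ring
theorem hp_three (t : ℕ) : hp t 3 = t ^ 2 + t + 1 := by simp [hp, Finset.sum_range_succ]; ring

section bounds
variable {K : Type*} [NormedField K]

theorem norm_pow_hp_le {t m n : ℕ} (hmn : m ≤ n) {q : K} {R : ℝ} (hq : ‖q‖ ≤ R) (hR : R ≤ 1) :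
    ‖q ^ hp t n‖ ≤ R ^ hp t m := by
  rw [norm_pow]
  have h0 := norm_nonneg q
  exact (pow_le_pow_of_le_one h0 (hq.trans hR) (hp_mono t hmn)).trans (pow_le_pow_left₀ h0 hq _)

theorem one_sub_norm_ge {w : K} {z : ℝ} (hw : ‖w‖ ≤ z) : 1 - z ≤ ‖1 - w‖ := by
  have := norm_sub_norm_le (1:K) w
  rw [norm_one] at this
  linarith

theorem norm_div_one_sub_le {w : K} {z : ℝ} (hw : ‖w‖ ≤ z) (hz : z < 1) :
    ‖w / (1 - w)‖ ≤ z / (1 - z) := by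
  rw [norm_div]
  have h := one_sub_norm_ge hw
  have h0 := norm_nonneg w
  exact div_le_div₀ (h0.trans hw) hw (by linarith) h

theorem norm_xx_le {t m n : ℕ} (hmn : m ≤ n) {q : K} {R : ℝ} (hq : ‖q‖ ≤ R) (hR : R ≤ 1)
    (hz : R ^ hp t m < 1) : ‖xx t n q‖ ≤ R ^ hp t m / (1 - R ^ hp t m) :=
  norm_div_one_sub_le (norm_pow_hp_le hmn hq hR) hz

theorem norm_term_le {t m n : ℕ} (hmn : m ≤ n) {q : K} {R : ℝ} (hq : ‖q‖ ≤ R) (hR : R ≤ 1)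
    (hz : R ^ hp t m < 1) (j : ℕ) :
    ‖(-1) ^ j * ∏ i ∈ Finset.range j, xx t (n + i) q‖ ≤ (R ^ hp t m / (1 - R ^ hp t m)) ^ j := by
  rw [norm_mul, norm_pow, norm_neg, norm_one, one_pow, one_mul, norm_prod]
  calc ∏ i ∈ Finset.range j, ‖xx t (n + i) q‖
      ≤ ∏ i ∈ Finset.range j, (R ^ hp t m / (1 - R ^ hp t m)) :=
        Finset.prod_le_prod (fun i _ => norm_nonneg _)
          (fun i _ => norm_xx_le (by omega) hq hR hz)
    _ = _ := by rw [Finset.prod_const, Finset.card_range]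

theorem X_lt_one {z : ℝ} (hz2 : 2 * z < 1) (hz0 : 0 ≤ z) :
    0 ≤ z / (1 - z) ∧ z / (1 - z) < 1 := by
  constructor
  · apply div_nonneg hz0; linarith
  · rw [div_lt_one (by linarith)]; linarith

theorem X_geom {z : ℝ} (hz2 : 2 * z < 1) (hz0 : 0 ≤ z) :
    (1 - z / (1 - z))⁻¹ = (1 - z) / (1 - 2 * z) := by
  have h1 : 1 - z ≠ 0 := by intro h; linarith
  have h2 : 1 - 2 * z ≠ 0 := by intro h; linarith
  have : 1 - z / (1 - z) = (1 - 2 * z) / (1 - z) := by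
    rw [eq_div_iff h1, sub_mul, div_mul_cancel₀ _ h1]; ring
  rw [this, inv_div]

variable [CompleteSpace K]

theorem summable_term {t m n : ℕ} (hmn : m ≤ n) {q : K} {R : ℝ} (hq : ‖q‖ ≤ R) (hR : R ≤ 1)
    (hz2 : 2 * R ^ hp t m < 1) :
    Summable fun j : ℕ => (-1) ^ j * ∏ i ∈ Finset.range j, xx t (n + i) q := by
  have hz0 : 0 ≤ R ^ hp t m := pow_nonneg ((norm_nonneg q).trans hq) _
  obtain ⟨h0, h1⟩ := X_lt_one hz2 hz0
  exact Summable.of_norm_bounded (summable_geometric_of_lt_one h0 h1)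
    (norm_term_le hmn hq hR (by linarith))

theorem norm_TT_le {t m n : ℕ} (hmn : m ≤ n) {q : K} {R : ℝ} (hq : ‖q‖ ≤ R) (hR : R ≤ 1)
    (hz2 : 2 * R ^ hp t m < 1) :
    ‖TT t n q‖ ≤ (1 - R ^ hp t m) / (1 - 2 * R ^ hp t m) := by
  have hz0 : 0 ≤ R ^ hp t m := pow_nonneg ((norm_nonneg q).trans hq) _
  obtain ⟨h0, h1⟩ := X_lt_one hz2 hz0
  rw [← X_geom hz2 hz0, ← tsum_geometric_of_lt_one h0 h1]
  exact tsum_of_norm_bounded (summable_geometric_of_lt_one h0 h1).hasSum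
    (norm_term_le hmn hq hR (by linarith))

theorem term_succ (t n : ℕ) (q : K) (j : ℕ) :
    (-1) ^ (j + 1) * ∏ i ∈ Finset.range (j + 1), xx t (n + i) q =
      -xx t n q * ((-1) ^ j * ∏ i ∈ Finset.range j, xx t (n + 1 + i) q) := by
  rw [Finset.prod_range_succ', add_zero, pow_succ]
  have : ∏ k ∈ Finset.range j, xx t (n + (k + 1)) q = ∏ i ∈ Finset.range j, xx t (n + 1 + i) q :=
    Finset.prod_congr rfl fun i _ => by rw [show n + (i + 1) = n + 1 + i by omega]
  rw [this]
  ring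

theorem summable_prev {t n : ℕ} {q : K}
    (h : Summable fun j : ℕ => (-1) ^ j * ∏ i ∈ Finset.range j, xx t (n + 1 + i) q) :
    Summable fun j : ℕ => (-1) ^ j * ∏ i ∈ Finset.range j, xx t (n + i) q := by
  rw [← summable_nat_add_iff 1]
  simp only [term_succ]
  exact h.mul_left _

theorem TT_rec {t n : ℕ} {q : K}
    (h : Summable fun j : ℕ => (-1) ^ j * ∏ i ∈ Finset.range j, xx t (n + 1 + i) q) :
    TT t n q = 1 - xx t n q * TT t (n + 1) q := by
  unfold TT
  rw [(summable_prev h).tsum_eq_zero_add]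
  simp only [term_succ]
  rw [h.tsum_mul_left]
  simp
  ring

theorem norm_TT_sub_one_le {t m n : ℕ} (hmn : m ≤ n) {q : K} {R : ℝ} (hq : ‖q‖ ≤ R) (hR : R ≤ 1)
    (hz2 : 2 * R ^ hp t m < 1) :
    ‖TT t n q - 1‖ ≤ R ^ hp t m / (1 - 2 * R ^ hp t m) := by
  have hz0 : 0 ≤ R ^ hp t m := pow_nonneg ((norm_nonneg q).trans hq) _
  have h1 : 1 - R ^ hp t m ≠ 0 := by intro h; linarith
  rw [TT_rec (summable_term (m := m) (by omega) hq hR hz2)]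
  have : 1 - xx t n q * TT t (n + 1) q - 1 = -(xx t n q * TT t (n + 1) q) := by ring
  rw [this, norm_neg, norm_mul]
  calc _ ≤ (R ^ hp t m / (1 - R ^ hp t m)) * ((1 - R ^ hp t m) / (1 - 2 * R ^ hp t m)) := by
        apply mul_le_mul (norm_xx_le hmn hq hR (by linarith))
          (norm_TT_le (by omega) hq hR hz2) (norm_nonneg _) (X_lt_one hz2 hz0).1
    _ = _ := by rw [div_mul_div_cancel₀ h1]

/-- The fixed point map. -/
def ph (t : ℕ) (q : K) : K := (1 + q * xx t 2 q * TT t 3 q) / 2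

end bounds

theorem bGF_eq {t : ℕ} {q : ℂ}
    (h : Summable fun j : ℕ => (-1) ^ j * ∏ i ∈ Finset.range j, xx t (2 + i) q) :
    1 - bGF t q 1 1 1 = TT t 1 q := by
  unfold bGF TT
  rw [(summable_prev (n := 1) h).tsum_eq_zero_add, sub_eq_add_neg, ← tsum_neg]
  simp only [Finset.range_zero, Finset.prod_empty, pow_zero, mul_one]
  congr 1
  apply tsum_congr
  intro j
  have e : Finset.Icc 1 j = Finset.image (fun i => 1 + i) (Finset.range j) := by
    ext a
    simp only [Finset.mem_Icc, Finset.mem_image, Finset.mem_range]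
    constructor
    · rintro ⟨h1, h2⟩; exact ⟨a - 1, by omega, by omega⟩
    · rintro ⟨b, h1, h2⟩; omega
  rw [e, Finset.prod_image (by intro a _ b _ h; simpa using h), Finset.prod_range_succ]
  have e2 : ∀ i, (1 - 1 - q ^ hp t (1 + i) * 1 ^ t ^ (1 + i)) / (1 - q ^ hp t (1 + i) * 1 ^ t ^ (1 + i))
      = -1 * xx t (1 + i) q := by
    intro i; simp [xx, neg_div]
  simp only [e2]
  rw [Finset.prod_mul_distrib, Finset.prod_const, Finset.card_range, pow_succ]
  simp only [xx, one_pow, mul_one, one_mul, add_comm]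
  ring

theorem summable2 {t : ℕ} {q : ℂ} {R : ℝ} (hq : ‖q‖ ≤ R) (hR : R ≤ 1)
    (hz2 : 2 * R ^ hp t 3 < 1) :
    Summable fun j : ℕ => (-1) ^ j * ∏ i ∈ Finset.range j, xx t (2 + i) q :=
  summable_prev (summable_term (m := 3) le_rfl hq hR hz2)

theorem one_sub_bGF {t : ℕ} {q : ℂ} {R : ℝ} (hq : ‖q‖ ≤ R) (hR : R < 1)
    (hz2 : 2 * R ^ hp t 3 < 1) :
    1 - bGF t q 1 1 1 = 2 * (ph t q - q) / (1 - q) := by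
  rw [bGF_eq (summable2 hq hR.le hz2), TT_rec (summable2 hq hR.le hz2),
    TT_rec (summable_term (m := 3) le_rfl hq hR.le hz2)]
  have h1 : 1 - q ≠ 0 := by
    intro h
    have := one_sub_norm_ge hq
    rw [h, norm_zero] at this
    linarith
  rw [xx, hp_one, pow_one, eq_div_iff h1, ph]
  norm_num
  have := div_mul_cancel₀ q h1
  linear_combination (- (1 - xx t 2 q * TT t 3 q)) * this

theorem bGF_eq_one_iff {t : ℕ} {q : ℂ} {R : ℝ} (hq : ‖q‖ ≤ R) (hR : R < 1)
    (hz2 : 2 * R ^ hp t 3 < 1) : bGF t q 1 1 1 = 1 ↔ ph t q = q := by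
  have h1 : 1 - q ≠ 0 := by
    intro h
    have := one_sub_norm_ge hq
    rw [h, norm_zero] at this
    linarith
  have := one_sub_bGF hq hR hz2
  constructor
  · intro h
    rw [h, sub_self, eq_comm, div_eq_zero_iff] at this
    rcases this with this | this
    · linear_combination this / 2
    · exact absurd this h1
  · intro h
    rw [h, sub_self, mul_zero, zero_div] at this
    linear_combination -this

theorem diff_TT {t : ℕ} {R : ℝ} (hR : R < 1) (hz2 : 2 * R ^ hp t 3 < 1) :
    DifferentiableOn ℂ (fun q : ℂ => TT t 3 q) (Metric.ball 0 R) := by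
  by_cases hR0 : 0 ≤ R
  · have hz0 : 0 ≤ R ^ hp t 3 := pow_nonneg hR0 _
    obtain ⟨h0, h1⟩ := X_lt_one hz2 hz0
    refine Complex.differentiableOn_tsum_of_summable_norm (summable_geometric_of_lt_one h0 h1) ?_
      Metric.isOpen_ball ?_
    · intro j
      apply DifferentiableOn.const_mul
      apply DifferentiableOn.fun_finsetProd
      intro i _ q hq
      apply DifferentiableAt.differentiableWithinAt
      refine DifferentiableAt.fun_div (by fun_prop) (by fun_prop) ?_
      intro h
      have hq' : ‖q‖ ≤ R := by simpa using (Metric.mem_ball.mp hq).le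
      have := one_sub_norm_ge (norm_pow_hp_le (t := t) (m := 3) (n := 3 + i) (by omega) hq' hR.le)
      rw [h, norm_zero] at this
      linarith
    · intro j q hq
      have hq' : ‖q‖ ≤ R := by simpa using (Metric.mem_ball.mp hq).le
      exact norm_term_le le_rfl hq' hR.le (by linarith) j
  · rw [Metric.ball_eq_empty.mpr (by linarith)]
    exact differentiableOn_empty

theorem diff_ph {t : ℕ} {R : ℝ} (hR : R < 1) (hz2 : 2 * R ^ hp t 3 < 1) :
    DifferentiableOn ℂ (fun q : ℂ => ph t q) (Metric.ball 0 R) := by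
  unfold ph
  apply DifferentiableOn.div_const
  apply DifferentiableOn.const_add
  refine DifferentiableOn.fun_mul (DifferentiableOn.fun_mul differentiableOn_id ?_) (diff_TT hR hz2)
  intro q hq
  apply DifferentiableAt.differentiableWithinAt
  refine DifferentiableAt.fun_div (by fun_prop) (by fun_prop) ?_
  intro h
  have hq' : ‖q‖ < 1 := by
    have := Metric.mem_ball.mp hq
    rw [dist_zero_right] at this
    linarith
  have h2 : ‖q ^ hp t 2‖ < 1 := by
    rw [norm_pow]
    exact pow_lt_one₀ (norm_nonneg _) hq' (by rw [hp_two]; omega)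
  have : q ^ hp t 2 = 1 := by linear_combination -h
  rw [this, norm_one] at h2
  linarith

/-- The numerical condition guaranteeing `ph` maps the disc of radius `R` to a smaller one. -/
def Cond (t : ℕ) (R : ℝ) : Prop :=
  0 < R ∧ R < 1 ∧ 2 * R ^ hp t 3 < 1 ∧
  R * (R ^ hp t 2 / (1 - R ^ hp t 2)) * ((1 - R ^ hp t 3) / (1 - 2 * R ^ hp t 3)) < 2 * R - 1

theorem norm_qS_le {t : ℕ} {q : ℂ} {R : ℝ} (hq : ‖q‖ ≤ R) (hR0 : 0 < R) (hR : R < 1)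
    (hz2 : 2 * R ^ hp t 3 < 1) : ‖q * xx t 2 q * TT t 3 q‖ ≤
      R * (R ^ hp t 2 / (1 - R ^ hp t 2)) * ((1 - R ^ hp t 3) / (1 - 2 * R ^ hp t 3)) := by
  have h2 : R ^ hp t 2 < 1 := pow_lt_one₀ hR0.le hR (by rw [hp_two]; omega)
  have h2' : 0 ≤ R ^ hp t 2 := pow_nonneg hR0.le _
  have hnn : 0 ≤ R ^ hp t 2 / (1 - R ^ hp t 2) := div_nonneg h2' (by linarith)
  rw [norm_mul, norm_mul]
  refine mul_le_mul (mul_le_mul hq (norm_xx_le le_rfl hq hR.le h2) (norm_nonneg _) hR0.le)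
    (norm_TT_le le_rfl hq hR.le hz2) (norm_nonneg _) (mul_nonneg hR0.le hnn)

theorem norm_ph_le {t : ℕ} {R : ℝ} (hC : Cond t R) :
    ∃ R' < R, ∀ q : ℂ, ‖q‖ ≤ R → ‖ph t q‖ ≤ R' := by
  obtain ⟨hR0, hR1, hz2, hc⟩ := hC
  refine ⟨(1 + R * (R ^ hp t 2 / (1 - R ^ hp t 2)) * ((1 - R ^ hp t 3) / (1 - 2 * R ^ hp t 3))) / 2,
    by linarith, ?_⟩
  intro q hq
  have := norm_qS_le hq hR0 hR1 hz2
  unfold ph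
  rw [norm_div, Complex.norm_two]
  have h1 := norm_add_le (1:ℂ) (q * xx t 2 q * TT t 3 q)
  rw [norm_one] at h1
  linarith

theorem core {t : ℕ} {R : ℝ} (hC : Cond t R) {a : ℂ} (ha : ‖a‖ ≤ R) (hfa : bGF t a 1 1 1 = 1) :
    (∀ q : ℂ, ‖q‖ ≤ R → bGF t q 1 1 1 = 1 → q = a) ∧
    deriv (fun q : ℂ => 1 - bGF t q 1 1 1) a ≠ 0 := by
  obtain ⟨R', hR', hph⟩ := norm_ph_le hC
  obtain ⟨hR0, hR1, hz2, hc⟩ := hC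
  have hlt : ∀ q : ℂ, ‖q‖ ≤ R → bGF t q 1 1 1 = 1 → ph t q = q ∧ ‖q‖ < R := by
    intro q hq hb
    have h := (bGF_eq_one_iff hq hR1 hz2).1 hb
    refine ⟨h, ?_⟩
    have := hph q hq
    rw [h] at this
    linarith
  obtain ⟨hpa, hal⟩ := hlt a ha hfa
  have key := ball_fix (f := fun q => ph t q) hR0 hR' (diff_ph hR1 hz2)
    (fun z hz => hph z hz.le) hal hpa
  refine ⟨fun q hq hb => key.1 q (hlt q hq hb).2 (hlt q hq hb).1, ?_⟩
  have h1 : 1 - a ≠ 0 := by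
    intro h
    have := one_sub_norm_ge ha
    rw [h, norm_zero] at this
    linarith
  have hd : HasDerivAt (fun q => ph t q) (deriv (fun q => ph t q) a) a :=
    ((diff_ph hR1 hz2).differentiableAt
      (Metric.isOpen_ball.mem_nhds (by simpa using hal))).hasDerivAt
  have hev : (fun q : ℂ => 1 - bGF t q 1 1 1) =ᶠ[nhds a] fun q => 2 * (ph t q - q) / (1 - q) := by
    filter_upwards [Metric.isOpen_ball.mem_nhds (show a ∈ Metric.ball 0 R by simpa using hal)]
      with q hq
    exact one_sub_bGF (by simpa using (Metric.mem_ball.mp hq).le) hR1 hz2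
  rw [hev.deriv_eq]
  have hD := ((hd.fun_sub (hasDerivAt_id' a)).const_mul 2).fun_div
    ((hasDerivAt_id' a).const_sub 1) h1
  rw [hD.deriv, hpa]
  intro h0
  rw [div_eq_zero_iff] at h0
  rcases h0 with h0 | h0
  · have : (2 * (deriv (fun q => ph t q) a - 1)) * (1 - a) = 0 := by linear_combination h0
    rcases mul_eq_zero.mp this with h | h
    · exact key.2 (by linear_combination h / 2)
    · exact h1 h
  · exact h1 (pow_eq_zero_iff (two_ne_zero) |>.mp h0)

theorem TT_ofReal (t n : ℕ) (x : ℝ) : TT t n (x : ℂ) = ((TT t n x : ℝ) : ℂ) := by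
  unfold TT xx
  push_cast
  rfl

theorem ph_ofReal (t : ℕ) (x : ℝ) : ph t (x : ℂ) = ((ph t x : ℝ) : ℂ) := by
  unfold ph
  rw [TT_ofReal]
  unfold xx
  push_cast
  rfl

theorem exists_fix {t : ℕ} {lo hi R : ℝ} (hlo : 0 < lo) (hlh : lo ≤ hi) (hhR : hi < R)
    (hR : R < 1) (hz2 : 2 * R ^ hp t 3 < 1) (h1 : lo ≤ ph t lo) (h2 : ph t hi ≤ hi) :
    ∃ x : ℝ, lo ≤ x ∧ x ≤ hi ∧ ph t x = x ∧ bGF t (x : ℂ) 1 1 1 = 1 := by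
  have hcont : ContinuousOn (fun x : ℝ => ph t x - x) (Set.Icc lo hi) := by
    have h := (diff_ph hR hz2).continuousOn
    have hco : ContinuousOn (fun x : ℝ => (ph t (x : ℂ)).re) (Set.Icc lo hi) := by
      apply Complex.continuous_re.comp_continuousOn
      refine h.comp (by fun_prop) ?_
      intro x hx
      simp only [Metric.mem_ball, dist_zero_right, Complex.norm_real, Real.norm_eq_abs]
      rw [abs_of_pos (lt_of_lt_of_le hlo hx.1)]
      exact lt_of_le_of_lt hx.2 hhR
    simp only [ph_ofReal, Complex.ofReal_re] at hco
    exact hco.sub continuousOn_id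
  obtain ⟨x, hx, hx0⟩ := intermediate_value_Icc' hlh hcont
    (show (0:ℝ) ∈ Set.Icc (ph t hi - hi) (ph t lo - lo) from ⟨by linarith, by linarith⟩)
  have hx1 : ph t x = x := by simp only at hx0; linarith
  refine ⟨x, hx.1, hx.2, hx1, ?_⟩
  refine (bGF_eq_one_iff (R := R) ?_ hR hz2).2 ?_
  · rw [Complex.norm_real, Real.norm_eq_abs, abs_of_pos (lt_of_lt_of_le hlo hx.1)]
    linarith [hx.2]
  · rw [ph_ofReal, hx1]


theorem aGF_ne_zero {t r : ℕ} (ht : 2 ≤ t) (hr : 1 ≤ r) {x : ℝ} (hx0 : 0 < x) (hx : x ≤ 0.565) :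
    aGF t r (x : ℂ) 1 1 1 ≠ 0 := by
  set f : ℕ → ℂ := fun j => (x : ℂ) ^ (r * hp t j) * ∏ i ∈ Finset.Icc 1 j, (-1 * xx t i (x : ℂ))
    with hf
  have ha : aGF t r (x : ℂ) 1 1 1 = ∑' j, f j := by
    unfold aGF
    apply tsum_congr
    intro j
    simp only [hf, one_pow, mul_one, one_mul]
    congr 1
    apply Finset.prod_congr rfl
    intro i _
    simp [xx, neg_div]
  have hxn : ‖(x : ℂ)‖ ≤ 0.565 := by
    rw [Complex.norm_real, Real.norm_eq_abs, abs_of_pos hx0]; exact hx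
  have hx1 : ‖xx t 1 (x : ℂ)‖ ≤ 0.565 / 0.435 := by
    have := norm_xx_le (t := t) (m := 1) (n := 1) le_rfl hxn (by norm_num)
      (by rw [hp_one]; norm_num)
    rw [hp_one] at this
    norm_num at this ⊢
    exact this
  have hxi : ∀ i, 2 ≤ i → ‖xx t i (x : ℂ)‖ ≤ 1 / 4 := by
    intro i hi
    have h3 : ‖(x:ℂ) ^ hp t i‖ ≤ 0.2 := by
      have h := norm_pow_hp_le (t := t) (m := 2) (n := i) hi hxn (by norm_num)
      have h' : (0.565 : ℝ) ^ hp t 2 ≤ 0.565 ^ 3 :=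
        pow_le_pow_of_le_one (by norm_num) (by norm_num) (by rw [hp_two]; omega)
      refine h.trans (h'.trans (by norm_num))
    refine (norm_div_one_sub_le h3 (by norm_num)).trans (by norm_num)
  have hprod : ∀ j : ℕ, ‖∏ i ∈ Finset.Icc 1 (j + 1), (-1 * xx t i (x : ℂ))‖
      ≤ 0.565 / 0.435 * (1 / 4) ^ j := by
    intro j
    induction j with
    | zero => simpa using hx1
    | succ j ih =>
      rw [Finset.prod_Icc_succ_top (by omega), norm_mul, pow_succ, ← mul_assoc]
      refine mul_le_mul ih ?_ (norm_nonneg _) (by positivity)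
      rw [norm_mul, norm_neg, norm_one, one_mul]
      exact hxi _ (by omega)
  have hfj : ∀ j, ‖f (j + 1)‖ ≤ 0.565 * (0.565 / 0.435) * (1 / 4) ^ j := by
    intro j
    simp only [hf]
    rw [norm_mul, mul_assoc]
    refine mul_le_mul ?_ (hprod j) (norm_nonneg _) (by norm_num)
    rw [norm_pow]
    have h1 : 1 ≤ r * hp t (j + 1) := by
      have := hp_mono t (show 1 ≤ j + 1 by omega)
      rw [hp_one] at this
      exact Nat.one_le_iff_ne_zero.mpr (by positivity)
    calc ‖(x:ℂ)‖ ^ (r * hp t (j + 1)) ≤ ‖(x:ℂ)‖ ^ 1 :=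
          pow_le_pow_of_le_one (norm_nonneg _) (hxn.trans (by norm_num)) h1
      _ ≤ _ := by rw [pow_one]; exact hxn
  have hg := (hasSum_geometric_of_lt_one (r := (1/4 : ℝ)) (by norm_num) (by norm_num)).mul_left
    (0.565 * (0.565 / 0.435))
  have hs1 : Summable fun j => f (j + 1) := Summable.of_norm_bounded hg.summable hfj
  have hs : Summable f := (summable_nat_add_iff 1).mp hs1
  have hle := tsum_of_norm_bounded hg hfj
  rw [ha, hs.tsum_eq_zero_add]
  have hf0 : f 0 = 1 := by simp [hf, hp]
  rw [hf0]
  intro h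
  have : ∑' j, f (j + 1) = -1 := by linear_combination h
  rw [this] at hle
  norm_num at hle

theorem cond_two : Cond 2 0.64 := by
  unfold Cond; rw [hp_two, hp_three]; norm_num
theorem cond_three : Cond 3 0.76 := by
  unfold Cond; rw [hp_two, hp_three]; norm_num
theorem cond_four : Cond 4 0.82 := by
  unfold Cond; rw [hp_two, hp_three]; norm_num
theorem cond_five : Cond 5 0.856 := by
  unfold Cond; rw [hp_two, hp_three]; norm_num
theorem cond_six : Cond 6 0.8965 := by
  unfold Cond; rw [hp_two, hp_three]; norm_num

/-- Real bounds for `T_3`. -/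
theorem TT_real {t : ℕ} {x z : ℝ} (hx0 : 0 ≤ x) (hx1 : x ≤ 1) (hz : x ^ hp t 3 ≤ z)
    (hz2 : z ≤ 1 / 4) : |TT t 3 x - 1| ≤ 2 * z := by
  have h0 : 0 ≤ x ^ hp t 3 := pow_nonneg hx0 _
  have := norm_TT_sub_one_le (K := ℝ) (t := t) (m := 3) (n := 3) le_rfl (q := x) (R := x)
    (by rw [Real.norm_eq_abs, abs_of_nonneg hx0]) hx1 (by linarith)
  rw [Real.norm_eq_abs] at this
  refine this.trans ?_
  rw [div_le_iff₀ (by linarith)]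
  nlinarith

theorem small_fix {t : ℕ} (ht : 2 ≤ t) :
    ∃ x : ℝ, 1 / 2 ≤ x ∧ x ≤ 0.565 ∧ bGF t (x : ℂ) 1 1 1 = 1 := by
  have hp2 : 3 ≤ hp t 2 := by rw [hp_two]; omega
  have hp3 : 7 ≤ hp t 3 := by rw [hp_three]; nlinarith
  have hz : ∀ x : ℝ, 0 ≤ x → x ≤ 1 → x ^ hp t 3 ≤ x ^ 7 := fun x h0 h1 =>
    pow_le_pow_of_le_one h0 h1 hp3
  obtain ⟨x, h1, h2, -, h4⟩ := exists_fix (t := t) (lo := 1/2) (hi := 0.565) (R := 0.6)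
    (by norm_num) (by norm_num) (by norm_num) (by norm_num)
    (by have := hz 0.6 (by norm_num) (by norm_num); norm_num at this ⊢; linarith)
    (by
      unfold ph
      have hT := TT_real (t := t) (x := 1/2) (z := (1/2)^7) (by norm_num) (by norm_num)
        (hz _ (by norm_num) (by norm_num)) (by norm_num)
      have hT' := (abs_le.mp hT).1
      have hx2 : 0 ≤ xx t 2 (1/2 : ℝ) := by
        unfold xx
        have : (1/2:ℝ) ^ hp t 2 ≤ 1 := pow_le_one₀ (by norm_num) (by norm_num)
        exact div_nonneg (by positivity) (by linarith)
      have : 0 ≤ 1/2 * xx t 2 (1/2 : ℝ) * TT t 3 (1/2 : ℝ) :=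
        mul_nonneg (by linarith) (by norm_num at hT'; linarith)
      linarith)
    (by
      unfold ph
      have hT := TT_real (t := t) (x := 0.565) (z := (0.565)^7) (by norm_num) (by norm_num)
        (hz _ (by norm_num) (by norm_num)) (by norm_num)
      have hT' := (abs_le.mp hT).2
      have hT0 := (abs_le.mp hT).1
      have hx2 : xx t 2 (0.565 : ℝ) ≤ 0.565 ^ 3 / (1 - 0.565 ^ 3) := by
        unfold xx
        have : (0.565:ℝ) ^ hp t 2 ≤ 0.565 ^ 3 :=
          pow_le_pow_of_le_one (by norm_num) (by norm_num) hp2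
        exact div_le_div₀ (by norm_num) this (by norm_num) (by linarith)
      have : 0.565 * xx t 2 (0.565 : ℝ) * TT t 3 (0.565 : ℝ) ≤
          0.565 * (0.565 ^ 3 / (1 - 0.565 ^ 3)) * (1 + 2 * 0.565 ^ 7) := by
        gcongr
        · norm_num at hT0; linarith
        · linarith
      norm_num at this ⊢
      linarith)
  exact ⟨x, h1, h2, h4⟩


theorem pow_taylor_up (y : ℝ) (hy : 0 ≤ y) (m : ℕ) :
    (1 + y) ^ m ≤ 1 + m * y + m * (m - 1) / 2 * y ^ 2
      + m * (m - 1) * (m - 2) / 6 * y ^ 3 * (1 + y) ^ m := by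
  induction m with
  | zero => simp
  | succ m ih =>
    have h1 : 1 ≤ (1 + y) ^ (m + 1) := one_le_pow₀ (by linarith)
    have hc : (0:ℝ) ≤ m * (m - 1) / 2 := by
      rcases Nat.eq_zero_or_pos m with h | h
      · simp [h]
      · have : (1:ℝ) ≤ m := by exact_mod_cast h
        have : (0:ℝ) ≤ m * (m - 1) := mul_nonneg (by linarith) (by linarith)
        linarith
    have h2 : m * (m - 1) / 2 * y ^ 3 ≤ m * (m - 1) / 2 * y ^ 3 * (1 + y) ^ (m + 1) :=
      le_mul_of_one_le_right (mul_nonneg hc (by positivity)) h1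
    have h3 := mul_le_mul_of_nonneg_right ih (show 0 ≤ 1 + y by linarith)
    have h4 : (1 + y) ^ (m + 1) = (1 + y) ^ m * (1 + y) := pow_succ _ _
    push_cast
    calc (1 + y) ^ (m + 1) = (1 + y) ^ m * (1 + y) := h4
      _ ≤ _ := h3
      _ = 1 + (m + 1) * y + (m + 1) * m / 2 * y ^ 2 + m * (m - 1) / 2 * y ^ 3
          + m * (m - 1) * (m - 2) / 6 * y ^ 3 * (1 + y) ^ (m + 1) := by rw [h4]; ring
      _ ≤ 1 + (m + 1) * y + (m + 1) * m / 2 * y ^ 2 + m * (m - 1) / 2 * y ^ 3 * (1 + y) ^ (m + 1)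
          + m * (m - 1) * (m - 2) / 6 * y ^ 3 * (1 + y) ^ (m + 1) := by linarith
      _ = _ := by ring

theorem pow_taylor_low (y : ℝ) (hy : 0 ≤ y) (m : ℕ) :
    1 + m * y + m * (m - 1) / 2 * y ^ 2 ≤ (1 + y) ^ m := by
  induction m with
  | zero => simp
  | succ m ih =>
    have hc : (0:ℝ) ≤ m * (m - 1) / 2 := by
      rcases Nat.eq_zero_or_pos m with h | h
      · simp [h]
      · have : (1:ℝ) ≤ m := by exact_mod_cast h
        have : (0:ℝ) ≤ m * (m - 1) := mul_nonneg (by linarith) (by linarith)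
        linarith
    have h2 : 0 ≤ m * (m - 1) / 2 * y ^ 3 := mul_nonneg hc (by positivity)
    have h3 := mul_le_mul_of_nonneg_right ih (show 0 ≤ 1 + y by linarith)
    rw [pow_succ]
    push_cast
    refine le_trans ?_ h3
    nlinarith

theorem four_mul_le (t : ℕ) (ht : 4 ≤ t) : 4 * t ≤ 2 ^ t := by
  induction t, ht using Nat.le_induction with
  | base => norm_num
  | succ t ht ih => rw [pow_succ]; omega

/-- Basic facts about `W = 2^{-t}` -/
theorem W_facts {t : ℕ} (ht : 4 ≤ t) {W : ℝ} (hW : W = 1 / 2 ^ t) :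
    0 < W ∧ W ≤ 1 / 16 ∧ t * W ≤ 1 / 4 := by
  have h := four_mul_le t ht
  have h' : (4:ℝ) * t ≤ 2 ^ t := by exact_mod_cast h
  have hp : (0:ℝ) < 2 ^ t := by positivity
  have ht' : (4:ℝ) ≤ t := by exact_mod_cast ht
  subst hW
  refine ⟨by positivity, ?_, ?_⟩
  · rw [div_le_div_iff₀ hp (by norm_num)]; linarith
  · rw [mul_one_div, div_le_div_iff₀ hp (by norm_num)]; linarith

theorem E_le {t : ℕ} {W y : ℝ} (hW0 : 0 < W) (hW1 : W ≤ 1 / 16) (htW : t * W ≤ 1 / 4)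
    (hy0 : 0 ≤ y) (hy : y ≤ 0.3 * W) : (1 + y) ^ (t + 1) ≤ 1.11 := by
  have h1 : (1 + y) ^ (t + 1) ≤ Real.exp ((t + 1 : ℕ) * y) := by
    rw [Real.exp_nat_mul]
    exact pow_le_pow_left₀ (by linarith) (by linarith [Real.add_one_le_exp y]) _
  have h2 : ((t + 1 : ℕ) : ℝ) * y ≤ 0.09375 := by
    push_cast
    have : (t + 1 : ℝ) * y ≤ (t + 1) * (0.3 * W) := by gcongr
    nlinarith
  have h3 : Real.exp ((t + 1 : ℕ) * y) ≤ Real.exp 0.09375 := Real.exp_le_exp.mpr h2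
  have h4 : Real.exp 0.09375 ≤ 1.11 := by
    have := Real.add_one_le_exp (-0.09375 : ℝ)
    rw [Real.exp_neg] at this
    have hpos := Real.exp_pos (0.09375)
    have h5 : (Real.exp 0.09375)⁻¹ * Real.exp 0.09375 = 1 := inv_mul_cancel₀ hpos.ne'
    nlinarith
  linarith

/-- Reformulation of `ph` on the real axis near `1/2`. -/
theorem ph_near {t : ℕ} (ht : 4 ≤ t) {W y : ℝ} (hW : W = 1 / 2 ^ t) (hy0 : 0 ≤ y)
    (hy : y ≤ 0.3 * W) :
    ∃ D : ℝ, |D| ≤ W ^ 4 ∧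
      (W * (1 + y) ^ (t + 1) / 4 * (1 + 3 * y + D) ≤ y → ph t ((1 + y) / 2) ≤ (1 + y) / 2) ∧
      (y ≤ W * (1 + y) ^ (t + 1) / 4 * (1 + 3 * y + D) → (1 + y) / 2 ≤ ph t ((1 + y) / 2)) := by
  obtain ⟨hW0, hW1, htW⟩ := W_facts ht hW
  have hE := E_le hW0 hW1 htW hy0 hy
  have hE1 : 1 ≤ (1 + y) ^ (t + 1) := one_le_pow₀ (by linarith)
  set E := (1 + y) ^ (t + 1) with hEdef
  have hq : ((1 + y) / 2) ^ (t + 1) = W * E / 2 := by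
    rw [div_pow, hEdef, hW, pow_succ 2 t]
    field_simp
  have hq1 : (1 + y) / 2 ≤ 1 := by linarith
  have hq0 : 0 ≤ (1 + y) / 2 := by linarith
  have hqW : ((1 + y) / 2) ^ (t + 1) ≤ 0.555 * W := by rw [hq]; nlinarith
  have hW4 : 0 < W ^ 4 := by positivity
  have hz : ((1 + y) / 2) ^ hp t 3 ≤ 0.1 * W ^ 4 := by
    calc ((1 + y) / 2) ^ hp t 3 ≤ ((1 + y) / 2) ^ ((t + 1) * 4) :=
          pow_le_pow_of_le_one hq0 hq1 (by rw [hp_three]; nlinarith)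
      _ = (((1 + y) / 2) ^ (t + 1)) ^ 4 := pow_mul _ _ _
      _ ≤ (0.555 * W) ^ 4 := pow_le_pow_left₀ (pow_nonneg hq0 _) hqW _
      _ ≤ 0.1 * W ^ 4 := by rw [mul_pow]; nlinarith
  have hW4' : W ^ 4 ≤ (1/16) ^ 4 := pow_le_pow_left₀ hW0.le hW1 _
  have hT := TT_real hq0 hq1 hz (by norm_num at hW4'; linarith)
  refine ⟨(1 + y) * (TT t 3 ((1 + y) / 2) - 1), ?_, ?_⟩
  · rw [abs_mul, abs_of_nonneg (by linarith : 0 ≤ 1 + y)]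
    nlinarith [abs_nonneg (TT t 3 ((1 + y) / 2) - 1)]
  · have hpos : 0 < 1 - W * E / 2 := by nlinarith
    have hph : ph t ((1 + y) / 2) = (1 + W * E / 4 * (1 + y) * TT t 3 ((1 + y) / 2) /
        (1 - W * E / 2)) / 2 := by
      unfold ph xx
      rw [hp_two, hq]
      ring
    rw [hph]
    constructor
    · intro h
      have : W * E / 4 * (1 + y) * TT t 3 ((1 + y) / 2) / (1 - W * E / 2) ≤ y := by
        rw [div_le_iff₀ hpos]
        linarith
      linarith
    · intro h
      have : y ≤ W * E / 4 * (1 + y) * TT t 3 ((1 + y) / 2) / (1 - W * E / 2) := by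
        rw [le_div_iff₀ hpos]
        linarith
      linarith

set_option maxHeartbeats 2000000 in
theorem expansion_fix {t : ℕ} (ht : 4 ≤ t) {W c G : ℝ} (hW : W = 1 / 2 ^ t)
    (hc : c = t + 4) (hG : G = 3 * (t:ℝ) ^ 2 + 23 * t + 38) :
    ∃ x : ℝ, 1 / 2 ≤ x ∧ bGF t (x : ℂ) 1 1 1 = 1 ∧
      2 * x - 1 ≤ W * (1/4 + c * W / 16 + G * W ^ 2 / 128 + 0.14 * (t:ℝ) ^ 3 * W ^ 3) ∧
      W * (1/4 + c * W / 16 + G * W ^ 2 / 128 - 0.14 * (t:ℝ) ^ 3 * W ^ 3) ≤ 2 * x - 1 ∧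
      x ≤ 1 / 2 + 0.15 * W := by
  obtain ⟨hW0, hW1, htW⟩ := W_facts ht hW
  have ht4 : (4:ℝ) ≤ t := by exact_mod_cast ht
  set τ : ℝ := (t:ℝ) with hτ
  clear_value τ
  -- crude bounds
  have hs0 : 0 ≤ τ * W := by positivity
  have hcW : c * W ≤ 1 / 2 := by rw [hc]; linarith
  have hcW0 : 0 ≤ c * W := by rw [hc]; positivity
  have hs2 : (τ * W) ^ 2 ≤ (1 / 4) ^ 2 := pow_le_pow_left₀ hs0 htW 2
  have hs3 : (τ * W) ^ 3 ≤ (1 / 4) ^ 3 := pow_le_pow_left₀ hs0 htW 3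
  have hsW : τ * W * W ≤ 1 / 64 := by
    have := mul_le_mul htW hW1 hW0.le (by norm_num)
    linarith
  have hWW : W ^ 2 ≤ 1 / 256 := by
    have := pow_le_pow_left₀ hW0.le hW1 2
    linarith
  have hGW : G * W ^ 2 ≤ 0.7 := by
    have e : G * W ^ 2 = 3 * (τ * W) ^ 2 + 23 * (τ * W * W) + 38 * W ^ 2 := by rw [hG]; ring
    rw [e]; linarith
  have hGW0 : 0 ≤ G * W ^ 2 := by rw [hG]; positivity
  have hτ3 : τ ^ 3 * W ^ 3 ≤ 1 / 64 := by rw [← mul_pow]; linarith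
  have hτ30 : 0 ≤ τ ^ 3 * W ^ 3 := by positivity
  set V := 1/4 + c * W / 16 + G * W ^ 2 / 128 + 0.14 * τ ^ 3 * W ^ 3 with hV
  clear_value V
  set V' := 1/4 + c * W / 16 + G * W ^ 2 / 128 - 0.14 * τ ^ 3 * W ^ 3 with hV'
  clear_value V'
  have hV1 : V ≤ 0.29 := by rw [hV]; linarith
  have hV'1 : 1 / 4 ≤ V' := by
    have : 0.14 * τ ^ 3 * W ^ 3 ≤ c * W / 16 := by
      have h1 : τ ^ 3 * W ^ 3 = (τ * W) * (τ * W) ^ 2 := by ring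
      have h2 : (τ * W) * (τ * W) ^ 2 ≤ (τ * W) * (1/4) ^ 2 := by gcongr
      have h3 : τ * W ≤ c * W := by rw [hc, add_mul]; linarith
      linarith
    rw [hV']; linarith
  have hVV : V' ≤ V := by rw [hV, hV']; linarith
  -- size facts relative to τ
  have hc2 : c ≤ 2 * τ := by rw [hc]; linarith
  have hc0 : 0 < c := by rw [hc]; linarith
  have hτpos : 0 < τ := by linarith
  have hτa : 4 * τ ≤ τ ^ 2 := by
    have := mul_le_mul_of_nonneg_right ht4 hτpos.le
    linarith
  have hτ2 : 16 ≤ τ ^ 2 := by linarith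
  have hτb : 4 * τ ^ 2 ≤ τ ^ 3 := by
    have := mul_le_mul_of_nonneg_right ht4 (by positivity : 0 ≤ τ ^ 2)
    linarith
  have hτ3' : 64 ≤ τ ^ 3 := by linarith
  have hG2 : G ≤ 11.125 * τ ^ 2 := by rw [hG]; linarith
  have hG0 : 0 < G := by rw [hG]; positivity
  set P : ℝ := (τ ^ 2 + 7 * τ + 6) / 2 with hP
  clear_value P
  have hP2 : P ≤ 1.5625 * τ ^ 2 := by rw [hP]; linarith
  have hP0 : 0 < P := by rw [hP]; positivity
  have hGP : G / 32 = c ^ 2 / 16 + P / 16 := by rw [hG, hc, hP]; ring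
  have hW30 : 0 < W ^ 3 := by positivity
  -- upper point
  have hup : ph t ((1 + W * V) / 2) ≤ (1 + W * V) / 2 := by
    have hy0 : 0 ≤ W * V := mul_nonneg hW0.le (by linarith)
    have hy : W * V ≤ 0.3 * W := by
      have := mul_le_mul_of_nonneg_left hV1 hW0.le
      linarith
    obtain ⟨D, hD, hle, -⟩ := ph_near ht hW hy0 hy
    apply hle
    have hE := E_le hW0 hW1 (hτ ▸ htW) hy0 hy
    have hE1 : 1 ≤ (1 + W * V) ^ (t + 1) := one_le_pow₀ (by linarith)
    have htay := pow_taylor_up (W * V) hy0 (t + 1)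
    push_cast at htay
    rw [← hτ] at htay
    set E := (1 + W * V) ^ (t + 1) with hEdef
    clear_value E
    set y := W * V with hydef
    clear_value y
    have hD' := (abs_le.mp hD).2
    have hy' : y ≤ 0.02 := by linarith
    have hτc : 0 ≤ (τ + 1) * τ * (τ - 1) := mul_nonneg (by positivity) (by linarith)
    -- cubic remainder
    have hM : E * (1 + 3 * y) ≤ 1 + c * y + P * y ^ 2 + 0.7 * τ ^ 3 * y ^ 3 := by
      have h1 : (τ + 1) * (τ + 1 - 1) * (τ + 1 - 2) / 6 * y ^ 3 * E ≤
          (τ + 1) * τ * (τ - 1) / 6 * y ^ 3 * 1.11 := by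
        have : (τ + 1) * (τ + 1 - 1) * (τ + 1 - 2) / 6 = (τ + 1) * τ * (τ - 1) / 6 := by ring
        rw [this]
        have : 0 ≤ (τ + 1) * τ * (τ - 1) / 6 * y ^ 3 := by positivity
        exact mul_le_mul_of_nonneg_left hE this
      have h2 : E ≤ 1 + (τ + 1) * y + (τ + 1) * τ / 2 * y ^ 2
          + (τ + 1) * τ * (τ - 1) / 6 * y ^ 3 * 1.11 := by
        have : (τ + 1) * (τ + 1 - 1) / 2 * y ^ 2 = (τ + 1) * τ / 2 * y ^ 2 := by ring
        linarith
      have h3 := mul_le_mul_of_nonneg_right h2 (show 0 ≤ 1 + 3 * y by linarith)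
      refine h3.trans ?_
      have h4 : (1 + (τ + 1) * y + (τ + 1) * τ / 2 * y ^ 2
          + (τ + 1) * τ * (τ - 1) / 6 * y ^ 3 * 1.11) * (1 + 3 * y) =
          1 + c * y + P * y ^ 2 + y ^ 3 * (3 * (τ + 1) * τ / 2 +
            (τ + 1) * τ * (τ - 1) / 6 * 1.11 * (1 + 3 * y)) := by
        rw [hc, hP]; ring
      rw [h4]
      have h5 : 3 * (τ + 1) * τ / 2 + (τ + 1) * τ * (τ - 1) / 6 * 1.11 * (1 + 3 * y)
          ≤ 0.7 * τ ^ 3 := by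
        have h6 : (τ + 1) * τ * (τ - 1) / 6 * 1.11 * (1 + 3 * y) ≤
            (τ + 1) * τ * (τ - 1) / 6 * 1.11 * 1.06 := by
          apply mul_le_mul_of_nonneg_left (by linarith)
          positivity
        have h7 : (τ + 1) * τ * (τ - 1) = τ ^ 3 - τ := by ring
        rw [h7] at h6 ⊢
        have h8 : 3 * (τ + 1) * τ = 3 * τ ^ 2 + 3 * τ := by ring
        rw [h8]
        linarith
      have h9 : 0 ≤ y ^ 3 := by positivity
      have := mul_le_mul_of_nonneg_left h5 h9
      linarith
    have hED : E * D ≤ 1.11 * W ^ 4 := by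
      have : E * D ≤ E * W ^ 4 := mul_le_mul_of_nonneg_left hD' (by linarith)
      have : E * W ^ 4 ≤ 1.11 * W ^ 4 := by gcongr
      linarith
    have hgoal : 1 + c * y + P * y ^ 2 + 0.7 * τ ^ 3 * y ^ 3 + 1.11 * W ^ 4 ≤ 4 * V := by
      have hVm : V - 1/4 ≤ W * (0.16 * τ) := by
        have e : V - 1/4 = W * (c / 16 + G * W / 128 + 0.14 * τ ^ 3 * W ^ 2) := by rw [hV]; ring
        rw [e]
        apply mul_le_mul_of_nonneg_left _ hW0.le
        have h1 : G * W ≤ 11.125 * τ * (1/4) := by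
          calc G * W ≤ 11.125 * τ ^ 2 * W := by gcongr
            _ = 11.125 * τ * (τ * W) := by ring
            _ ≤ _ := by gcongr
        have h2 : τ ^ 3 * W ^ 2 ≤ τ * (1/4) ^ 2 := by
          calc τ ^ 3 * W ^ 2 = τ * (τ * W) ^ 2 := by ring
            _ ≤ _ := by gcongr
        linarith
      have hVp : 0 ≤ V - 1/4 := by linarith
      have hV2 : P * (W ^ 2 * (V ^ 2 - 1/16)) ≤ W ^ 3 * (0.14 * τ ^ 3) := by
        have h1 : V ^ 2 - 1/16 ≤ W * (0.16 * τ) * 0.54 := by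
          have : V ^ 2 - 1/16 = (V - 1/4) * (V + 1/4) := by ring
          rw [this]
          apply mul_le_mul hVm (by linarith) (by linarith) (by positivity)
        calc P * (W ^ 2 * (V ^ 2 - 1/16)) ≤ 1.5625 * τ ^ 2 * (W ^ 2 * (W * (0.16 * τ) * 0.54)) := by
              apply mul_le_mul hP2 _ _ (by positivity)
              · gcongr
              · have : V ^ 2 - 1/16 = (V - 1/4) * (V + 1/4) := by ring
                rw [this]
                have : 0 ≤ V + 1/4 := by linarith
                positivity
          _ = W ^ 3 * τ ^ 3 * 0.135 := by ring
          _ ≤ _ := by linarith [mul_pos hW30 (by positivity : 0 < τ ^ 3)]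
      have hcG : c * G ≤ 22.25 * τ ^ 3 := by
        calc c * G ≤ (2 * τ) * (11.125 * τ ^ 2) := mul_le_mul hc2 hG2 hG0.le (by positivity)
          _ = _ := by ring
      have h3 : c * W * (0.14 * τ ^ 3 * W ^ 3) ≤ W ^ 3 * (0.07 * τ ^ 3) := by
        have : 0 ≤ 0.14 * τ ^ 3 * W ^ 3 := by positivity
        have := mul_le_mul_of_nonneg_right hcW this
        linarith
      have h4 : 0.7 * τ ^ 3 * y ^ 3 ≤ W ^ 3 * (0.02 * τ ^ 3) := by
        have hV3 : V ^ 3 ≤ 0.29 ^ 3 := pow_le_pow_left₀ (by linarith) hV1 3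
        have : 0.7 * τ ^ 3 * y ^ 3 = W ^ 3 * τ ^ 3 * (0.7 * V ^ 3) := by rw [hydef]; ring
        rw [this]
        have hpos : 0 < W ^ 3 * τ ^ 3 := by positivity
        have : W ^ 3 * τ ^ 3 * (0.7 * V ^ 3) ≤ W ^ 3 * τ ^ 3 * 0.02 :=
          mul_le_mul_of_nonneg_left (by norm_num at hV3; linarith) hpos.le
        linarith
      have h5 : 1.11 * W ^ 4 ≤ W ^ 3 * (0.01 * τ ^ 3) := by
        have e : 1.11 * W ^ 4 = W ^ 3 * (1.11 * W) := by ring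
        rw [e]
        exact mul_le_mul_of_nonneg_left (by linarith) hW30.le
      have h6 : W ^ 3 * (c * G / 128) ≤ W ^ 3 * (0.18 * τ ^ 3) := by
        apply mul_le_mul_of_nonneg_left _ hW30.le
        have : 0 ≤ τ ^ 3 := by positivity
        linarith
      have e1 : c * y = c * W / 4 + c ^ 2 * W ^ 2 / 16 + W ^ 3 * (c * G / 128)
          + c * W * (0.14 * τ ^ 3 * W ^ 3) := by rw [hydef, hV]; ring
      have e2 : P * y ^ 2 = P * (W ^ 2 * (V ^ 2 - 1/16)) + P / 16 * W ^ 2 := by rw [hydef]; ring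
      have e3 : 4 * V = 1 + c * W / 4 + (c ^ 2 / 16 + P / 16) * W ^ 2 + W ^ 3 * (0.56 * τ ^ 3) := by
        rw [hV, ← hGP]; ring
      have hpos : 0 < W ^ 3 * τ ^ 3 := by positivity
      linarith
    have hfin : E * (1 + 3 * y + D) ≤ 4 * V := by
      have : E * (1 + 3 * y + D) = E * (1 + 3 * y) + E * D := by ring
      linarith
    calc W * E / 4 * (1 + 3 * y + D) = W / 4 * (E * (1 + 3 * y + D)) := by ring
      _ ≤ W / 4 * (4 * V) := by gcongr
      _ = y := by rw [hydef]; ring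
  have hlow : (1 + W * V') / 2 ≤ ph t ((1 + W * V') / 2) := by
    have hy0 : 0 ≤ W * V' := mul_nonneg hW0.le (by linarith)
    have hy : W * V' ≤ 0.3 * W := by
      have := mul_le_mul_of_nonneg_left (hVV.trans hV1) hW0.le
      linarith
    obtain ⟨D, hD, -, hle⟩ := ph_near ht hW hy0 hy
    apply hle
    have hE := E_le hW0 hW1 (hτ ▸ htW) hy0 hy
    have hE1 : 1 ≤ (1 + W * V') ^ (t + 1) := one_le_pow₀ (by linarith)
    have htay := pow_taylor_low (W * V') hy0 (t + 1)
    push_cast at htay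
    rw [← hτ] at htay
    set E := (1 + W * V') ^ (t + 1) with hEdef
    clear_value E
    set y := W * V' with hydef
    clear_value y
    have hD' := (abs_le.mp hD).1
    have hM : 1 + c * y + P * y ^ 2 ≤ E * (1 + 3 * y) := by
      have h3 := mul_le_mul_of_nonneg_right htay (show 0 ≤ 1 + 3 * y by linarith)
      refine le_trans ?_ h3
      have h4 : (1 + (τ + 1) * y + (τ + 1) * (τ + 1 - 1) / 2 * y ^ 2) * (1 + 3 * y) =
          1 + c * y + P * y ^ 2 + y ^ 3 * (3 * (τ + 1) * τ / 2) := by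
        rw [hc, hP]; ring
      rw [h4]
      have : 0 ≤ y ^ 3 * (3 * (τ + 1) * τ / 2) := by positivity
      linarith
    have hED : - (1.11 * W ^ 4) ≤ E * D := by
      have : E * (-W ^ 4) ≤ E * D := mul_le_mul_of_nonneg_left hD' (by linarith)
      have : E * W ^ 4 ≤ 1.11 * W ^ 4 := by gcongr
      linarith
    have hgoal : 4 * V' ≤ 1 + c * y + P * y ^ 2 - 1.11 * W ^ 4 := by
      have hV2 : 0 ≤ P * (W ^ 2 * (V' ^ 2 - 1/16)) := by
        have : V' ^ 2 - 1/16 = (V' - 1/4) * (V' + 1/4) := by ring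
        rw [this]
        have h1 : 0 ≤ V' - 1/4 := by linarith
        have h2 : 0 ≤ V' + 1/4 := by linarith
        positivity
      have h3 : c * W * (0.14 * τ ^ 3 * W ^ 3) ≤ W ^ 3 * (0.07 * τ ^ 3) := by
        have : 0 ≤ 0.14 * τ ^ 3 * W ^ 3 := by positivity
        have := mul_le_mul_of_nonneg_right hcW this
        linarith
      have h5 : 1.11 * W ^ 4 ≤ W ^ 3 * (0.01 * τ ^ 3) := by
        have e : 1.11 * W ^ 4 = W ^ 3 * (1.11 * W) := by ring
        rw [e]
        exact mul_le_mul_of_nonneg_left (by linarith) hW30.le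
      have h6 : 0 ≤ W ^ 3 * (c * G / 128) := by positivity
      have e1 : c * y = c * W / 4 + c ^ 2 * W ^ 2 / 16 + W ^ 3 * (c * G / 128)
          - c * W * (0.14 * τ ^ 3 * W ^ 3) := by rw [hydef, hV']; ring
      have e2 : P * y ^ 2 = P * (W ^ 2 * (V' ^ 2 - 1/16)) + P / 16 * W ^ 2 := by rw [hydef]; ring
      have e3 : 4 * V' = 1 + c * W / 4 + (c ^ 2 / 16 + P / 16) * W ^ 2 - W ^ 3 * (0.56 * τ ^ 3) := by
        rw [hV', ← hGP]; ring
      have hpos : 0 < W ^ 3 * τ ^ 3 := by positivity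
      linarith
    have hfin : 4 * V' ≤ E * (1 + 3 * y + D) := by
      have : E * (1 + 3 * y + D) = E * (1 + 3 * y) + E * D := by ring
      linarith
    calc y = W / 4 * (4 * V') := by rw [hydef]; ring
      _ ≤ W / 4 * (E * (1 + 3 * y + D)) := by gcongr
      _ = W * E / 4 * (1 + 3 * y + D) := by ring
  have hWV : W * V' ≤ W * V := by gcongr
  have hWV' : 0 ≤ W * V' := mul_nonneg hW0.le (by linarith)
  have hWVle : W * V ≤ 0.29 * W := by
    have := mul_le_mul_of_nonneg_left hV1 hW0.le
    linarith
  have hz : 2 * (0.6:ℝ) ^ hp t 3 < 1 := by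
    have : (0.6:ℝ) ^ hp t 3 ≤ 0.6 ^ 7 :=
      pow_le_pow_of_le_one (by norm_num) (by norm_num) (by rw [hp_three]; clear * - ht; nlinarith)
    norm_num at this ⊢
    linarith
  obtain ⟨x, hx1, hx2, -, hx4⟩ := exists_fix (t := t) (lo := (1 + W * V') / 2)
    (hi := (1 + W * V) / 2) (R := 0.6) (by linarith) (by linarith) (by linarith) (by norm_num)
    hz hlow hup
  exact ⟨x, by linarith, hx4, by linarith, by linarith, by linarith⟩


theorem big_exp {s x : ℝ} (hs0 : 0 < s) (hs : s ≤ 1 / 7)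
    (hx : x * (1 + s) = s * (Real.log 2 + 0.42 * s)) :
    0 < x ∧ Real.exp x ≤ 1 + s * Real.log 2 + 0.0063 * s ^ 2 := by
  have hL1 := Real.log_two_gt_d9
  have hL2 := Real.log_two_lt_d9
  set L := Real.log 2
  clear_value L
  have hx0 : 0 < x := by
    by_contra h
    have : x * (1 + s) ≤ 0 := mul_nonpos_of_nonpos_of_nonneg (by linarith) (by linarith)
    have : 0 < s * (L + 0.42 * s) := by positivity
    linarith
  have hxu : x ≤ s * (L - 0.234 * s) := by
    by_contra! h
    have h1 := mul_lt_mul_of_pos_right h (show 0 < 1 + s by linarith)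
    rw [hx] at h1
    have h2 : s * (L - 0.234 * s) * (1 + s) = s * ((L - 0.234 * s) * (1 + s)) := by ring
    rw [h2] at h1
    have h3 := lt_of_mul_lt_mul_left h1 hs0.le
    nlinarith
  have hxs : x ≤ 0.6932 * s := by nlinarith
  have hx1 : x ≤ 1 := by linarith
  have hb := Real.exp_bound' hx0.le hx1 (n := 3) (by norm_num)
  norm_num [Finset.sum_range_succ, Nat.factorial] at hb
  have h2 : x ^ 2 ≤ s ^ 2 * (L - 0.234 * s) ^ 2 := by
    rw [← mul_pow]; exact pow_le_pow_left₀ hx0.le hxu 2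
  have h3 : x ^ 3 ≤ s ^ 3 * 0.3332 := by
    calc x ^ 3 ≤ (0.6932 * s) ^ 3 := pow_le_pow_left₀ hx0.le hxs 3
      _ = s ^ 3 * 0.6932 ^ 3 := by ring
      _ ≤ _ := by gcongr; norm_num
  refine ⟨hx0, ?_⟩
  have h4 : (L - 0.234 * s) ^ 2 ≤ 0.48046 - 0.324 * s + 0.055 * s ^ 2 := by nlinarith
  have h5 : s ^ 2 * (L - 0.234 * s) ^ 2 ≤ s ^ 2 * (0.48046 - 0.324 * s + 0.055 * s ^ 2) := by
    gcongr
  have h6 : s ^ 4 ≤ s ^ 3 * (1/7) := by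
    calc s ^ 4 = s ^ 3 * s := by ring
      _ ≤ _ := by gcongr
  have h7 : 0 < s ^ 3 := by positivity
  nlinarith

theorem big_W {t : ℕ} (ht : 7 ≤ t) : 128 * t ^ 2 ≤ 49 * 2 ^ t := by
  induction t, ht using Nat.le_induction with
  | base => norm_num
  | succ t ht ih => rw [pow_succ 2 t]; nlinarith

theorem big_alg {s Y z e : ℝ} (hs0 : 0 < s) (hs : s ≤ 1 / 7) (hY0 : 0 < Y)
    (hY : Y * (1 + 0.84 * s + 0.1764 * s ^ 2) ≤ 1) (hz0 : 0 ≤ z)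
    (hz : z ≤ 0.2543 * s ^ 2) (he : e ≤ 1 + 0.6932 * s + 0.0063 * s ^ 2) :
    Y * ((1 - z) / (1 - 2 * z)) < 2 - e := by
  have hs2 : s ^ 2 ≤ 1 / 49 := by nlinarith
  have hz1 : 0 < 1 - 2 * z := by linarith
  have hK : (1 - z) / (1 - 2 * z) ≤ 1 + 0.257 * s ^ 2 := by
    rw [div_le_iff₀ hz1]
    nlinarith
  have h1 : Y * ((1 - z) / (1 - 2 * z)) ≤ Y * (1 + 0.257 * s ^ 2) := by gcongr
  refine h1.trans_lt (lt_of_lt_of_le ?_ (by linarith : 1 - 0.6932 * s - 0.0063 * s ^ 2 ≤ 2 - e))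
  have hM : 1 + 0.257 * s ^ 2 < (1 - 0.6932 * s - 0.0063 * s ^ 2) *
      (1 + 0.84 * s + 0.1764 * s ^ 2) := by
    have : s ^ 3 ≤ s ^ 2 * (1/7) := by
      calc s ^ 3 = s ^ 2 * s := by ring
        _ ≤ _ := by gcongr
    have : s ^ 4 ≤ s ^ 2 * (1/49) := by
      calc s ^ 4 = s ^ 2 * s ^ 2 := by ring
        _ ≤ _ := by gcongr
    have : s ^ 2 ≤ s * (1/7) := by nlinarith
    nlinarith
  have hpos : 0 < 1 - 0.6932 * s - 0.0063 * s ^ 2 := by linarith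
  calc Y * (1 + 0.257 * s ^ 2) < Y * ((1 - 0.6932 * s - 0.0063 * s ^ 2) *
      (1 + 0.84 * s + 0.1764 * s ^ 2)) := by gcongr
    _ = (Y * (1 + 0.84 * s + 0.1764 * s ^ 2)) * (1 - 0.6932 * s - 0.0063 * s ^ 2) := by ring
    _ ≤ 1 * (1 - 0.6932 * s - 0.0063 * s ^ 2) := by gcongr
    _ = _ := one_mul _

theorem big_R {t : ℕ} (ht : 7 ≤ t) {W : ℝ} (hW : W = 1 / 2 ^ t) :
    ∃ R : ℝ, Cond t R ∧ 1 - 0.72 / (t:ℝ) ≤ R ∧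
      ∀ x₀ : ℝ, 1/2 ≤ x₀ → 2 * x₀ - 1 ≤ 0.26 * W →
        x₀ / (1/2 + Real.log 2 / (2*t) + 0.06 / (t : ℝ)^2) ≤ R := by
  have ht7 : (7:ℝ) ≤ t := by exact_mod_cast ht
  have htp : (0:ℝ) < t := by linarith
  obtain ⟨s, hs⟩ : ∃ s : ℝ, s = 1 / t := ⟨_, rfl⟩
  have hst : s * t = 1 := by rw [hs]; field_simp
  have hs0 : 0 < s := by rw [hs]; positivity
  have hs7 : s ≤ 1 / 7 := by rw [hs]; gcongr
  have hL1 := Real.log_two_gt_d9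
  have hL2 := Real.log_two_lt_d9
  obtain ⟨x, hx⟩ : ∃ x : ℝ, x = (Real.log 2 + 0.42 * s) / (t + 1) := ⟨_, rfl⟩
  have hxt : x * (t + 1) = Real.log 2 + 0.42 * s := by rw [hx]; field_simp
  have hxs : x * (1 + s) = s * (Real.log 2 + 0.42 * s) := by
    rw [← hxt]
    linear_combination (-x) * hst
  obtain ⟨hx0, hexp⟩ := big_exp hs0 hs7 hxs
  have hWs : W ≤ 49 / 128 * s ^ 2 := by
    have h := big_W ht
    have h' : (128:ℝ) * t ^ 2 ≤ 49 * 2 ^ t := by exact_mod_cast h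
    rw [hW, hs, div_pow, one_pow, mul_one_div, div_div, div_le_div_iff₀ (by positivity) (by positivity)]
    linarith
  have hW0 : 0 < W := by rw [hW]; positivity
  have hR1 : Real.exp (-x) * Real.exp x = 1 := by rw [← Real.exp_add]; simp
  have hy : Real.exp (-x) ^ (t + 1) * (2 * Real.exp (0.42 * s)) = 1 := by
    rw [← Real.exp_nat_mul]
    have h2 : (2:ℝ) = Real.exp (Real.log 2) := (Real.exp_log (by norm_num)).symm
    nth_rewrite 1 [h2]
    rw [← Real.exp_add, ← Real.exp_add]
    push_cast
    rw [Real.exp_eq_one_iff]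
    linarith
  have hR0 := Real.exp_pos (-x)
  have hRlt : Real.exp (-x) < 1 := by rw [Real.exp_lt_one_iff]; linarith
  have hz : Real.exp (-x) ^ hp t 3 ≤ 0.664 * W := by
    have h1 : Real.exp (-x) ^ hp t 3 ≤ Real.exp (-x) ^ ((t + 1) * t) :=
      pow_le_pow_of_le_one hR0.le hRlt.le (by rw [hp_three]; nlinarith)
    have h2 : Real.exp (-x) ^ ((t + 1) * t) * (2 ^ t * Real.exp 0.42) = 1 := by
      have : Real.exp 0.42 = Real.exp (0.42 * s) ^ t := by
        rw [← Real.exp_nat_mul]; congr 1; linear_combination (-0.42) * hst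
      rw [this, pow_mul, ← mul_pow, ← mul_pow, hy, one_pow]
    have h3 : 1.5082 ≤ Real.exp 0.42 := by
      have := Real.quadratic_le_exp_of_nonneg (show (0:ℝ) ≤ 0.42 by norm_num)
      norm_num at this ⊢
      linarith
    have h4 : Real.exp (-x) ^ ((t + 1) * t) * Real.exp 0.42 = W := by
      rw [hW, eq_div_iff (by positivity)]; linarith
    have h5 : 0 ≤ Real.exp (-x) ^ ((t + 1) * t) := by positivity
    have h6 := mul_le_mul_of_nonneg_left h3 h5
    linarith
  have hs2 : s ^ 2 ≤ 1 / 49 := by nlinarith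
  refine ⟨Real.exp (-x), ⟨hR0, hRlt, by linarith, ?_⟩, ?_, ?_⟩
  · rw [hp_two]
    have hq := Real.quadratic_le_exp_of_nonneg (show (0:ℝ) ≤ 0.42 * s by positivity)
    set y := Real.exp (-x) ^ (t + 1)
    have hy0 : 0 < y := by positivity
    have hy1 : 0 < 1 - y := by nlinarith
    have hY : y / (1 - y) * (1 + 0.84 * s + 0.1764 * s ^ 2) ≤ 1 := by
      rw [div_mul_eq_mul_div, div_le_one hy1]
      have := mul_le_mul_of_nonneg_left hq hy0.le
      nlinarith
    have h := big_alg hs0 hs7 (by positivity) hY (by positivity : 0 ≤ Real.exp (-x) ^ hp t 3)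
      (by linarith) (show Real.exp x ≤ _ by nlinarith)
    have h' := mul_lt_mul_of_pos_left h hR0
    linarith
  · have h1 := Real.add_one_le_exp (-x)
    have h2 : x ≤ 0.72 / t := by
      rw [le_div_iff₀ htp]
      nlinarith
    linarith
  · intro x₀ hx₀ hx₁
    have hQ : 1/2 + Real.log 2 / (2*t) + 0.06 / (t : ℝ)^2 = (1 + s * Real.log 2 + 0.12 * s ^ 2) / 2 := by
      rw [hs]; field_simp; ring
    rw [hQ]
    have hQ0 : 0 < (1 + s * Real.log 2 + 0.12 * s ^ 2) / 2 := by positivity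
    rw [div_le_iff₀ hQ0]
    have hk : 2 * x₀ * Real.exp x ≤ 1 + s * Real.log 2 + 0.12 * s ^ 2 := by
      have h1 : Real.exp x ≤ 1.1 := by nlinarith
      have h2 : 2 * x₀ * Real.exp x ≤ (1 + 0.26 * W) * Real.exp x :=
        mul_le_mul_of_nonneg_right (by linarith) (Real.exp_pos x).le
      have h3 := mul_le_mul_of_nonneg_left h1 (show 0 ≤ 0.26 * W by positivity)
      nlinarith
    have h := mul_le_mul_of_nonneg_left hk hR0.le
    have e : Real.exp (-x) * (2 * x₀ * Real.exp x) = 2 * x₀ := by linear_combination (2 * x₀) * hR1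
    rw [e] at h
    linarith


theorem le_of_sq_le_sq_aux {a b : ℝ} (h : a ^ 2 ≤ b ^ 2) (hb : 0 ≤ b) : a ≤ b :=
  le_trans (le_abs_self a) (abs_le_of_sq_le_sq h hb)

theorem six_M1 {M P e : ℝ} (h : M ^ 2 = (1 - P) ^ 2 + P * e) (hP : P ≤ 0.46876) (hP0 : 0.46 ≤ P)
    (he : 0 ≤ e) (hM0 : 0 ≤ M) : 0.53124 ≤ M := by
  apply le_of_sq_le_sq_aux _ hM0
  rw [h]
  have := mul_nonneg (by linarith : 0 ≤ P) he
  nlinarith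

theorem six_M2 {M P e : ℝ} (h : M ^ 2 = (1 - P) ^ 2 + P * e) (hP : P ≤ 0.46876) (hP0 : 0.46 ≤ P)
    (he : 0.15 ^ 2 ≤ e) (hM0 : 0 ≤ M) : 0.54 ≤ M := by
  apply le_of_sq_le_sq_aux _ hM0
  rw [h]
  have := mul_le_mul hP0 he (by norm_num) (by linarith)
  nlinarith

theorem six_N {N p d k : ℝ} (h : N ^ 2 = (1 - 2 * p) ^ 2 + 2 * p * d ^ 2) (hp : 0.8965 ≤ p)
    (hd : k ^ 2 ≤ d ^ 2) : 0.793 ^ 2 + 1.793 * k ^ 2 ≤ N ^ 2 := by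
  rw [h]
  have := mul_le_mul (by linarith : 1.793 ≤ 2 * p) hd (by positivity) (by linarith)
  nlinarith

theorem six_d {d w : ℝ} (h : d * (7 - 21 * d) ≤ w) (h1 : 1 / 43 ≤ d) (h2 : d ≤ 0.082) :
    0.15 ≤ w := by
  have := mul_le_mul h1 (by linarith : 5.278 ≤ 7 - 21 * d) (by norm_num) (by linarith)
  nlinarith [mul_nonneg (sub_nonneg.2 h1) (sub_nonneg.2 h2)]


theorem nrm_sq {v : ℂ} (hv : ‖v‖ = 1) (P : ℝ) :
    ‖1 - (P:ℂ) * v‖ ^ 2 = (1 - P) ^ 2 + P * ‖v - 1‖ ^ 2 := by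
  have h : ‖v‖ ^ 2 = 1 := by rw [hv]; norm_num
  rw [Complex.sq_norm, Complex.normSq_apply] at h ⊢
  rw [Complex.sq_norm, Complex.normSq_apply]
  simp
  linear_combination (P ^ 2 - P) * h

theorem pow_sub_one_norm {u : ℂ} (hu : ‖u‖ = 1) (k : ℕ) : ‖u ^ k - 1‖ ≤ k * ‖u - 1‖ := by
  induction k with
  | zero => simp
  | succ k ih =>
    have e : u ^ (k + 1) - 1 = u ^ k * (u - 1) + (u ^ k - 1) := by ring
    rw [e]
    refine (norm_add_le _ _).trans ?_
    rw [norm_mul, norm_pow, hu, one_pow]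
    push_cast
    linarith

theorem pow7_lower {u : ℂ} (hu : ‖u‖ = 1) : ‖u - 1‖ * (7 - 21 * ‖u - 1‖) ≤ ‖u ^ 7 - 1‖ := by
  obtain ⟨S, hS⟩ : ∃ S : ℂ, S = (u ^ 1 - 1) + (u ^ 2 - 1) + (u ^ 3 - 1) + (u ^ 4 - 1) + (u ^ 5 - 1)
    + (u ^ 6 - 1) := ⟨_, rfl⟩
  have e : u ^ 7 - 1 = (u - 1) * (7 + S) := by rw [hS]; ring
  have hSn : ‖S‖ ≤ 21 * ‖u - 1‖ := by
    have h1 := pow_sub_one_norm hu 1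
    have h2 := pow_sub_one_norm hu 2
    have h3 := pow_sub_one_norm hu 3
    have h4 := pow_sub_one_norm hu 4
    have h5 := pow_sub_one_norm hu 5
    have h6 := pow_sub_one_norm hu 6
    rw [hS]
    refine (norm_add_le_of_le (norm_add_le_of_le (norm_add_le_of_le (norm_add_le_of_le
      (norm_add_le_of_le h1 h2) h3) h4) h5) h6).trans ?_
    push_cast
    linarith
  rw [e, norm_mul]
  apply mul_le_mul_of_nonneg_left _ (norm_nonneg _)
  have h7 : ‖(7:ℂ)‖ ≤ ‖7 + S‖ + ‖S‖ := by
    have := norm_sub_le (7 + S) S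
    simpa using this
  norm_num at h7
  linarith

set_option maxHeartbeats 1000000 in
theorem annulus_six {q : ℂ} (h1 : 0.8965 ≤ ‖q‖) (h2 : ‖q‖ ≤ 0.89741) : bGF 6 q 1 1 1 ≠ 1 := by
  have h43 : (0.89741:ℝ) ^ hp 6 3 ≤ 0.00953 := by rw [hp_three]; norm_num
  have h430 : (0:ℝ) ≤ 0.89741 ^ hp 6 3 := by positivity
  have hR1 : (0.89741:ℝ) ≤ 1 := by norm_num
  have hz2 : 2 * (0.89741:ℝ) ^ hp 6 3 < 1 := by linarith
  intro hb
  rw [bGF_eq_one_iff h2 (by norm_num) hz2] at hb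
  have hKpos : 0 < 1 - 2 * (0.89741:ℝ) ^ hp 6 3 := by linarith
  -- polar form
  obtain ⟨p, hpdef⟩ : ∃ p : ℝ, p = ‖q‖ := ⟨_, rfl⟩
  rw [← hpdef] at h1 h2
  have hp0 : 0 < p := by linarith
  obtain ⟨u, hudef⟩ : ∃ u : ℂ, u = q / p := ⟨_, rfl⟩
  have hpc : (p:ℂ) ≠ 0 := by exact_mod_cast hp0.ne'
  have hqu : q = p * u := by rw [hudef]; field_simp
  have hu : ‖u‖ = 1 := by
    rw [hudef, norm_div, ← hpdef, Complex.norm_real, Real.norm_of_nonneg hp0.le, div_self hp0.ne']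
  obtain ⟨d, hd⟩ : ∃ d : ℝ, d = ‖u - 1‖ := ⟨_, rfl⟩
  have hd0 : 0 ≤ d := by rw [hd]; positivity
  obtain ⟨N, hN⟩ : ∃ N : ℝ, N = ‖1 - 2 * q‖ := ⟨_, rfl⟩
  obtain ⟨M, hM⟩ : ∃ M : ℝ, M = ‖1 - q ^ 7‖ := ⟨_, rfl⟩
  obtain ⟨T, hT⟩ : ∃ T : ℝ, T = ‖TT 6 3 q‖ := ⟨_, rfl⟩
  have hN0 : 0 ≤ N := by rw [hN]; positivity
  have hM0 : 0 ≤ M := by rw [hM]; positivity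
  have hT0 : 0 ≤ T := by rw [hT]; positivity
  have hNsq : N ^ 2 = (1 - 2 * p) ^ 2 + 2 * p * d ^ 2 := by
    have := nrm_sq hu (2 * p)
    rw [hN, hd, ← this, hqu]
    push_cast
    rw [mul_assoc]
  have hMsq : M ^ 2 = (1 - p ^ 7) ^ 2 + p ^ 7 * ‖u ^ 7 - 1‖ ^ 2 := by
    have := nrm_sq (v := u ^ 7) (by rw [norm_pow, hu, one_pow]) (p ^ 7)
    rw [hM, ← this, hqu]
    push_cast
    rw [mul_pow]
  have hP7 : p ^ 7 ≤ 0.46876 := (pow_le_pow_left₀ hp0.le h2 7).trans (by norm_num)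
  have hP70 : 0.46 ≤ p ^ 7 := le_trans (by norm_num) (pow_le_pow_left₀ (by norm_num) h1 7)
  have hP8 : p * p ^ 7 ≤ 0.42067 := by
    have := (pow_le_pow_left₀ hp0.le h2 8).trans (show _ ≤ (0.42067:ℝ) by norm_num)
    calc p * p ^ 7 = p ^ 8 := by ring
      _ ≤ _ := this
  have hM1 : 0.53124 ≤ M := six_M1 hMsq hP7 hP70 (sq_nonneg _) hM0
  have hN1 : 0.793 ≤ N := by
    apply le_of_sq_le_sq_aux _ hN0
    have := six_N (k := 0) hNsq h1 (by simpa using sq_nonneg d)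
    linarith
  have hMne : 1 - q ^ 7 ≠ 0 := by
    intro h
    rw [h, norm_zero] at hM
    linarith
  have hkey : N * M = p * p ^ 7 * T := by
    have e : 2 * q - 1 = q * xx 6 2 q * TT 6 3 q := by
      unfold ph at hb
      linear_combination (-2) * hb
    have e2 : (2 * q - 1) * (1 - q ^ 7) = q * q ^ 7 * TT 6 3 q := by
      rw [e]
      unfold xx
      rw [hp_two]
      have : q ^ (6 + 1) = q ^ 7 := rfl
      rw [this]
      field_simp
    have e3 := congrArg norm e2
    rw [norm_mul, norm_mul, norm_mul, norm_pow, norm_sub_rev, ← hN, ← hM, ← hT, ← hpdef] at e3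
    exact e3
  have hqR : ‖q‖ ≤ 0.89741 := by rw [← hpdef]; exact h2
  have hT1 : T ≤ 1.0098 := by
    have := norm_TT_le (le_refl 3) hqR hR1 hz2
    rw [hT]
    refine this.trans ?_
    rw [div_le_iff₀ hKpos]
    linarith
  have hpp : 0 ≤ p * p ^ 7 := by positivity
  have hub : p * p ^ 7 * T ≤ 0.42067 * 1.0098 := mul_le_mul hP8 hT1 hT0 (by norm_num)
  rcases le_total 0.082 d with hA | hA
  · have hN2 : 0.8005 ≤ N := by
      apply le_of_sq_le_sq_aux _ hN0
      have : (0.082:ℝ) ^ 2 ≤ d ^ 2 := pow_le_pow_left₀ (by norm_num) hA 2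
      have := six_N hNsq h1 this
      refine le_trans (by norm_num) this
    have := mul_le_mul hN2 hM1 (by norm_num) hN0
    linarith
  rcases le_total (1/43) d with hB | hB
  · have h7 := pow7_lower hu
    rw [← hd] at h7
    have h8 : 0.15 ≤ ‖u ^ 7 - 1‖ := six_d h7 hB hA
    have h9 : (0.15:ℝ) ^ 2 ≤ ‖u ^ 7 - 1‖ ^ 2 := pow_le_pow_left₀ (by norm_num) h8 2
    have hM2 : 0.54 ≤ M := six_M2 hMsq hP7 hP70 h9 hM0
    have := mul_le_mul hN1 hM2 (by norm_num) hN0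
    linarith
  · have hv : ‖u ^ 43‖ = 1 := by rw [norm_pow, hu, one_pow]
    have he : ‖u ^ 43 - 1‖ ≤ 1 := by
      have := pow_sub_one_norm hu 43
      rw [← hd] at this
      push_cast at this
      linarith
    have hz : q ^ 43 = ((p ^ 43 : ℝ) : ℂ) * u ^ 43 := by rw [hqu, mul_pow]; push_cast; ring
    have hP43 : p ^ 43 ≤ 0.00953 := (pow_le_pow_left₀ hp0.le h2 43).trans (by norm_num)
    have hP430 : 0 ≤ p ^ 43 := by positivity
    have hle : ‖1 - 2 * q ^ 43‖ ≤ ‖1 - q ^ 43‖ := by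
      apply le_of_sq_le_sq_aux _ (norm_nonneg _)
      have e1 := nrm_sq hv (p ^ 43)
      have e2 := nrm_sq hv (2 * p ^ 43)
      rw [← hz] at e1
      have e3 : 1 - ((2 * p ^ 43 : ℝ) : ℂ) * u ^ 43 = 1 - 2 * q ^ 43 := by
        rw [hz]; push_cast; ring
      rw [e3] at e2
      rw [e1, e2]
      have : ‖u ^ 43 - 1‖ ^ 2 ≤ 1 := by
        have := pow_le_pow_left₀ (norm_nonneg (u ^ 43 - 1)) he 2
        simpa using this
      clear * - this hP43 hP430
      nlinarith
    have hzn : ‖q ^ 43‖ ≤ 0.00953 := by rw [norm_pow, ← hpdef]; exact hP43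
    have h1z : 0.99 ≤ ‖1 - q ^ 43‖ := by
      have := one_sub_norm_ge hzn
      linarith
    have hzne : 1 - q ^ 43 ≠ 0 := by
      intro h
      rw [h, norm_zero] at h1z
      norm_num at h1z
    have h3 : hp 6 3 = 43 := by rw [hp_three]; norm_num
    have hx3 : ‖xx 6 3 q‖ ≤ 0.0097 := by
      unfold xx
      rw [h3, norm_div, div_le_iff₀ (by linarith)]
      linarith
    have h1x : ‖1 - xx 6 3 q‖ ≤ 1 := by
      have e : 1 - xx 6 3 q = (1 - 2 * q ^ 43) / (1 - q ^ 43) := by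
        unfold xx
        rw [h3]
        field_simp
        ring
      rw [e, norm_div, div_le_one (by linarith)]
      exact hle
    have hT4 : ‖TT 6 4 q - 1‖ ≤ 0.01 := by
      have := norm_TT_sub_one_le (show 3 ≤ 4 by norm_num) hqR hR1 hz2
      refine this.trans ?_
      rw [div_le_iff₀ hKpos]
      linarith
    have hrec : TT 6 3 q = (1 - xx 6 3 q) - xx 6 3 q * (TT 6 4 q - 1) := by
      rw [TT_rec (t := 6) (n := 3) (q := q) (summable_term (show 3 ≤ 4 by norm_num) hqR hR1 hz2)]
      ring
    have hT2 : T ≤ 1.0001 := by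
      rw [hT, hrec]
      refine (norm_sub_le _ _).trans ?_
      rw [norm_mul]
      have := mul_le_mul hx3 hT4 (norm_nonneg _) (by norm_num)
      linarith
    have hub2 : p * p ^ 7 * T ≤ 0.42067 * 1.0001 := mul_le_mul hP8 hT2 hT0 (by norm_num)
    have := mul_le_mul hN1 hM1 (by norm_num) hN0
    linarith


/-- Translation of the expansion bounds. -/
theorem expansion_abs {t : ℕ} {W x : ℝ} (hW : W = 1 / 2 ^ t)
    (hu : 2 * x - 1 ≤ W * (1/4 + ((t:ℝ) + 4) * W / 16 + (3 * (t:ℝ) ^ 2 + 23 * t + 38) * W ^ 2 / 128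
      + 0.14 * (t:ℝ) ^ 3 * W ^ 3))
    (hl : W * (1/4 + ((t:ℝ) + 4) * W / 16 + (3 * (t:ℝ) ^ 2 + 23 * t + 38) * W ^ 2 / 128
      - 0.14 * (t:ℝ) ^ 3 * W ^ 3) ≤ 2 * x - 1) :
    |x - (1/2 + 1/2^(t+3) + ((t : ℝ) + 4)/2^(2*t+5)
            + (3*(t : ℝ)^2 + 23*t + 38)/2^(3*t+8))|
          ≤ 7 * (t : ℝ)^3 / (100 * 2^(4*t)) := by
  have e1 : (1:ℝ)/2^(t+3) = W / 8 := by rw [hW, pow_add]; field_simp; norm_num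
  have e2 : ((t : ℝ) + 4)/2^(2*t+5) = ((t : ℝ) + 4) * W ^ 2 / 32 := by
    rw [hW, pow_add, mul_comm 2 t, pow_mul]; field_simp; norm_num
  have e3 : (3*(t : ℝ)^2 + 23*t + 38)/2^(3*t+8) = (3*(t : ℝ)^2 + 23*t + 38) * W ^ 3 / 256 := by
    rw [hW, pow_add, mul_comm 3 t, pow_mul]; field_simp; norm_num
  have e4 : 7 * (t : ℝ)^3 / (100 * 2^(4*t)) = 0.07 * (t:ℝ) ^ 3 * W ^ 4 := by
    rw [hW, mul_comm 4 t, pow_mul]; field_simp; ring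
  rw [e1, e2, e3, e4, abs_le]
  constructor <;> linarith

theorem two_x_le {t : ℕ} (ht : 7 ≤ t) {W x : ℝ} (hW : W = 1 / 2 ^ t)
    (hu : 2 * x - 1 ≤ W * (1/4 + ((t:ℝ) + 4) * W / 16 + (3 * (t:ℝ) ^ 2 + 23 * t + 38) * W ^ 2 / 128
      + 0.14 * (t:ℝ) ^ 3 * W ^ 3)) : 2 * x - 1 ≤ 0.26 * W := by
  have hn : 128 * t ≤ 7 * 2 ^ t := by
    clear hu
    induction t, ht using Nat.le_induction generalizing W with
    | base => norm_num
    | succ t ht ih => rw [pow_succ]; have := ih rfl; omega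
  have hn' : (128:ℝ) * t ≤ 7 * 2 ^ t := by exact_mod_cast hn
  have ht7 : (7:ℝ) ≤ t := by exact_mod_cast ht
  have hW0 : 0 < W := by rw [hW]; positivity
  have hWt : W * 2 ^ t = 1 := by rw [hW]; field_simp
  have htW : t * W ≤ 7 / 128 := by
    have := mul_le_mul_of_nonneg_left hn' hW0.le
    linarith
  have hW1 : W ≤ 1 / 128 := by
    have := mul_le_mul_of_nonneg_right ht7 hW0.le
    linarith
  have htW0 : 0 ≤ t * W := by positivity
  have a2 := pow_le_pow_left₀ htW0 htW 2
  have a3 := pow_le_pow_left₀ htW0 htW 3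
  have b2 := pow_le_pow_left₀ hW0.le hW1 2
  have ab := mul_le_mul htW hW1 hW0.le (by norm_num)
  have hb : 1/4 + ((t:ℝ) + 4) * W / 16 + (3 * (t:ℝ) ^ 2 + 23 * t + 38) * W ^ 2 / 128
      + 0.14 * (t:ℝ) ^ 3 * W ^ 3 ≤ 0.26 := by
    have e : 1/4 + ((t:ℝ) + 4) * W / 16 + (3 * (t:ℝ) ^ 2 + 23 * t + 38) * W ^ 2 / 128
      + 0.14 * (t:ℝ) ^ 3 * W ^ 3 = 1/4 + (t * W) / 16 + W / 4 + (3 * (t * W) ^ 2 + 23 * (t * W * W)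
        + 38 * W ^ 2) / 128 + 0.14 * (t * W) ^ 3 := by ring
    rw [e]
    norm_num at a2 a3 b2 ab
    linarith
  have := mul_le_mul_of_nonneg_left hb hW0.le
  linarith

theorem assemble {t r : ℕ} (ht : 2 ≤ t) (hr : 1 ≤ r) {x R : ℝ} (hx1 : 1/2 ≤ x) (hx2 : x ≤ 0.565)
    (hx3 : bGF t (x:ℂ) 1 1 1 = 1) (hC : Cond t R) (hRx : x ≤ R) (hRt : 1 - 0.72 / (t:ℝ) ≤ R)
    (hxt : x < 1 - 0.72 / (t:ℝ)) :
    0 < x ∧ x < 1 - 0.72 / t ∧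
      bGF t (x : ℂ) 1 1 1 = 1 ∧
      (∀ q : ℂ, ‖q‖ < 1 - 0.72 / t → bGF t q 1 1 1 = 1 → q = (x : ℂ)) ∧
      deriv (fun q : ℂ => 1 - bGF t q 1 1 1) (x : ℂ) ≠ 0 ∧
      aGF t r (x : ℂ) 1 1 1 ≠ 0 := by
  have hx0 : 0 < x := by linarith
  have hn : ‖(x:ℂ)‖ ≤ R := by rw [Complex.norm_real, Real.norm_of_nonneg hx0.le]; exact hRx
  obtain ⟨h1, h2⟩ := core hC hn hx3
  exact ⟨hx0, hxt, hx3, fun q hq => h1 q (by linarith), h2, aGF_ne_zero ht hr hx0 hx2⟩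


/-- The generating function `H(q,1,1,1) = a(q,1,1,1)/(1 − b(q,1,1,1))`
of canonical `t`-ary forests with `r` roots has exactly one singularity `q₀` with
`|q| < 1 − 0.72/t`; it is a simple pole (simple zero of the denominator, non-vanishing
numerator), positive, independent of `r`, with the stated asymptotic expansion for
`t ≥ 4`; and for `t ≥ 6`, with `Q = 1/2 + log 2/(2t) + 0.06/t²`, `q₀` is the only
singularity `q` with `|q| ≤ q₀/Q`. -/
theorem dominant_singularity (t r : ℕ) (ht : 2 ≤ t) (hr : 1 ≤ r) :
    ∃ q₀ : ℝ, 0 < q₀ ∧ q₀ < 1 - 0.72 / t ∧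
      bGF t (q₀ : ℂ) 1 1 1 = 1 ∧
      (∀ q : ℂ, ‖q‖ < 1 - 0.72 / t → bGF t q 1 1 1 = 1 → q = (q₀ : ℂ)) ∧
      deriv (fun q : ℂ => 1 - bGF t q 1 1 1) (q₀ : ℂ) ≠ 0 ∧
      aGF t r (q₀ : ℂ) 1 1 1 ≠ 0 ∧
      (4 ≤ t →
        |q₀ - (1/2 + 1/2^(t+3) + ((t : ℝ) + 4)/2^(2*t+5)
            + (3*(t : ℝ)^2 + 23*t + 38)/2^(3*t+8))|
          ≤ 7 * (t : ℝ)^3 / (100 * 2^(4*t))) ∧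
      (6 ≤ t →
        ∀ q : ℂ, ‖q‖ ≤ q₀ / (1/2 + Real.log 2 / (2*t) + 0.06 / (t : ℝ)^2) →
          bGF t q 1 1 1 = 1 → q = (q₀ : ℂ)) := by
  rcases Nat.lt_or_ge t 4 with h4 | h4
  · obtain ⟨x, hx1, hx2, hx3⟩ := small_fix ht
    have hxx : ∃ R : ℝ, Cond t R ∧ x ≤ R ∧ 1 - 0.72 / (t:ℝ) ≤ R ∧ x < 1 - 0.72 / (t:ℝ) := by
      interval_cases t
      · exact ⟨_, cond_two, by norm_num at hx2 ⊢; linarith, by norm_num,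
          by norm_num at hx2 ⊢; linarith⟩
      · exact ⟨_, cond_three, by norm_num at hx2 ⊢; linarith, by norm_num,
          by norm_num at hx2 ⊢; linarith⟩
    obtain ⟨R, hC, hRx, hRt, hxt⟩ := hxx
    obtain ⟨a1, a2, a3, a4, a5, a6⟩ := assemble ht hr hx1 hx2 hx3 hC hRx hRt hxt
    exact ⟨x, a1, a2, a3, a4, a5, a6, fun h => by omega, fun h => by omega⟩
  · obtain ⟨W, hW⟩ : ∃ W : ℝ, W = 1 / 2 ^ t := ⟨_, rfl⟩
    obtain ⟨x, hx1, hx3, hu, hl, hx2⟩ := expansion_fix h4 hW rfl rfl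
    obtain ⟨hW0, hW1, -⟩ := W_facts h4 hW
    have hx2' : x ≤ 0.51 := by linarith
    have hx2'' : x ≤ 0.565 := by linarith
    have habs := expansion_abs hW hu hl
    have ht4 : (4:ℝ) ≤ t := by exact_mod_cast h4
    have htd : 0.72 / (t:ℝ) ≤ 0.18 := by
      rw [div_le_iff₀ (by linarith)]; linarith
    have hxt : x < 1 - 0.72 / (t:ℝ) := by linarith
    rcases Nat.lt_or_ge t 6 with h6 | h6
    · have hxx : ∃ R : ℝ, Cond t R ∧ x ≤ R ∧ 1 - 0.72 / (t:ℝ) ≤ R := by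
        clear habs hu hl
        interval_cases t
        · exact ⟨_, cond_four, by linarith, by norm_num⟩
        · exact ⟨_, cond_five, by linarith, by norm_num⟩
      obtain ⟨R, hC, hRx, hRt⟩ := hxx
      obtain ⟨a1, a2, a3, a4, a5, a6⟩ := assemble ht hr hx1 hx2'' hx3 hC hRx hRt hxt
      exact ⟨x, a1, a2, a3, a4, a5, a6, fun _ => habs, fun h => by omega⟩
    rcases Nat.lt_or_ge t 7 with h7 | h7
    · have e : t = 6 := by omega
      subst e
      have hC := cond_six
      have hRx : x ≤ 0.8965 := by linarith
      obtain ⟨a1, a2, a3, a4, a5, a6⟩ := assemble ht hr hx1 hx2'' hx3 hC hRx (by norm_num) hxt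
      refine ⟨x, a1, a2, a3, a4, a5, a6, fun _ => habs, fun _ q hq hb => ?_⟩
      have hn : ‖(x:ℂ)‖ ≤ 0.8965 := by
        rw [Complex.norm_real, Real.norm_of_nonneg a1.le]; exact hRx
      rcases le_total ‖q‖ 0.8965 with hq1 | hq1
      · exact (core hC hn hx3).1 q hq1 hb
      · exfalso
        refine annulus_six hq1 (hq.trans ?_) hb
        have hL1 := Real.log_two_gt_d9
        have hxs : x ≤ 0.502035 := by
          rw [hW] at hu
          norm_num at hu ⊢
          linarith
        have hQ : 0.559428 ≤ 1/2 + Real.log 2 / (2*(6:ℕ)) + 0.06 / ((6:ℕ) : ℝ)^2 := by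
          norm_num at hL1 ⊢
          linarith
        rw [div_le_iff₀ (by linarith)]
        have := mul_le_mul_of_nonneg_left hQ (show (0:ℝ) ≤ 0.89741 by norm_num)
        refine le_trans ?_ this
        norm_num at hxs ⊢
        linarith
    · obtain ⟨R, hC, hRt, hRQ⟩ := big_R h7 hW
      have hRx : x ≤ R := by linarith
      obtain ⟨a1, a2, a3, a4, a5, a6⟩ := assemble ht hr hx1 hx2'' hx3 hC hRx hRt hxt
      have hn : ‖(x:ℂ)‖ ≤ R := by rw [Complex.norm_real, Real.norm_of_nonneg a1.le]; exact hRx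
      exact ⟨x, a1, a2, a3, a4, a5, a6, fun _ => habs, fun _ q hq hb =>
        (core hC hn hx3).1 q (hq.trans (hRQ x hx1 (two_x_le h7 hW hu))) hb⟩

end
end

section
/- Fix an integer t ≥ 30 and let q_0(w) be the unique zero with |q_0(w)| < 2/3 of q ↦ D(q,w), where D(q,w) = 1 − b(q,1,1,w) = Σ_{j≥0} (−1)^j w^j ∏_{i=1}^{j} q^{h_i}/(1−q^{h_i}). Then for all real φ with |φ| ≤ √(97/96)·π·2^{−t/2}, the second derivative (d²/dφ²) |q_0(e^{iφ})|² is strictly positive; in particular, at φ = 0 it equals 1/8 + ε·144/2^{t/2} with |ε| ≤ 1 and hence exceeds 0.1206. -/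
open scoped BigOperators
open Filter MeasureTheory

noncomputable section

/-- the denominator `D(q,w) = 1 − b(q,1,1,w) = Σ_{j≥0} (−1)^j w^j ∏_{i=1}^{j} q^{h_i}/(1−q^{h_i})` -/
def DGF (t : ℕ) (q w : ℂ) : ℂ :=
  ∑' j : ℕ, (-1 : ℂ) ^ j * w ^ j * ∏ i ∈ Finset.Icc 1 j, q ^ hp t i / (1 - q ^ hp t i)

/-- the factor `q^{h_{i+2}}/(1-q^{h_{i+2}})` -/
def auxF (t : ℕ) (q : ℂ) (i : ℕ) : ℂ := q ^ hp t (i + 2) / (1 - q ^ hp t (i + 2))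

/-- terms of the remainder series -/
def auxT (t : ℕ) (q w : ℂ) (j : ℕ) : ℂ :=
  (-w) ^ j * w ^ 2 * q * ∏ i ∈ Finset.range (j + 1), auxF t q i

/-- the remainder series -/
def auxS (t : ℕ) (q w : ℂ) : ℂ := ∑' j : ℕ, auxT t q w j

lemma hp_ge (t i : ℕ) : t + 1 ≤ hp t (i + 2) := by
  unfold hp
  have h : ∑ k ∈ Finset.range 2, t ^ k ≤ ∑ k ∈ Finset.range (i + 2), t ^ k :=
    Finset.sum_le_sum_of_subset (Finset.range_mono (by omega))
  simp [Finset.sum_range_succ] at h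
  simp [Finset.sum_range_succ]
  omega

lemma pow_small {t : ℕ} (ht : 30 ≤ t) {q : ℂ} (hq : ‖q‖ ≤ 3 / 4) :
    ‖q‖ ^ (t + 1) ≤ 1 / 5000 := by
  calc ‖q‖ ^ (t + 1) ≤ (3 / 4 : ℝ) ^ (t + 1) := by gcongr
    _ ≤ (3 / 4 : ℝ) ^ 31 := pow_le_pow_of_le_one (by norm_num) (by norm_num) (by omega)
    _ ≤ 1 / 5000 := by norm_num

lemma qpow_bound {t : ℕ} {q : ℂ} (hq : ‖q‖ ≤ 3 / 4) (i : ℕ) :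
    ‖q ^ hp t (i + 2)‖ ≤ ‖q‖ ^ (t + 1) := by
  rw [norm_pow]
  exact pow_le_pow_of_le_one (norm_nonneg _) (by linarith) (hp_ge t i)

lemma den_bound {t : ℕ} (ht : 30 ≤ t) {q : ℂ} (hq : ‖q‖ ≤ 3 / 4) (i : ℕ) :
    1 / 2 ≤ ‖1 - q ^ hp t (i + 2)‖ := by
  have h1 := qpow_bound (t := t) hq i
  have h2 := pow_small ht hq
  have h3 := norm_sub_norm_le (1 : ℂ) (q ^ hp t (i + 2))
  rw [norm_one] at h3
  linarith

lemma auxF_bound {t : ℕ} (ht : 30 ≤ t) {q : ℂ} (hq : ‖q‖ ≤ 3 / 4) (i : ℕ) :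
    ‖auxF t q i‖ ≤ 2 * ‖q‖ ^ (t + 1) := by
  have h1 := qpow_bound (t := t) hq i
  have h2 := den_bound ht hq i
  unfold auxF
  rw [norm_div, div_le_iff₀ (by linarith)]
  have : 0 ≤ ‖q‖ ^ (t + 1) := by positivity
  nlinarith

lemma auxT_bound {t : ℕ} (ht : 30 ≤ t) {q w : ℂ} (hq : ‖q‖ ≤ 3 / 4) (hw : ‖w‖ ≤ 5 / 4) (j : ℕ) :
    ‖auxT t q w j‖ ≤ 25 / 8 * ‖q‖ ^ (t + 2) * (1 / 2) ^ j := by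
  unfold auxT
  have hc := pow_small ht hq
  rw [norm_mul, norm_mul, norm_mul, norm_pow, norm_pow, norm_neg, norm_prod]
  have h1 : ∏ i ∈ Finset.range (j + 1), ‖auxF t q i‖ ≤ (2 * ‖q‖ ^ (t + 1)) ^ (j + 1) := by
    calc _ ≤ ∏ i ∈ Finset.range (j + 1), (2 * ‖q‖ ^ (t + 1)) :=
          Finset.prod_le_prod (fun _ _ => norm_nonneg _) (fun i _ => auxF_bound ht hq i)
      _ = _ := by simp
  calc ‖w‖ ^ j * ‖w‖ ^ 2 * ‖q‖ * ∏ i ∈ Finset.range (j + 1), ‖auxF t q i‖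
      ≤ ‖w‖ ^ j * ‖w‖ ^ 2 * ‖q‖ * (2 * ‖q‖ ^ (t + 1)) ^ (j + 1) := by gcongr
    _ = 2 * ‖w‖ ^ 2 * ‖q‖ ^ (t + 2) * (‖w‖ * (2 * ‖q‖ ^ (t + 1))) ^ j := by
        rw [mul_pow ‖w‖]; ring
    _ ≤ 2 * (5 / 4) ^ 2 * ‖q‖ ^ (t + 2) * (1 / 2) ^ j := by
        gcongr
        have : 0 ≤ ‖q‖ ^ (t + 1) := by positivity
        nlinarith [norm_nonneg w]
    _ = _ := by ring

lemma hasSum_half (c : ℝ) : HasSum (fun j : ℕ => c * (1 / 2 : ℝ) ^ j) (2 * c) := by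
  have := (hasSum_geometric_two).mul_left c
  rwa [mul_comm c 2] at this

lemma auxT_summable {t : ℕ} (ht : 30 ≤ t) {q w : ℂ} (hq : ‖q‖ ≤ 3 / 4) (hw : ‖w‖ ≤ 5 / 4) :
    Summable (auxT t q w) :=
  Summable.of_norm_bounded (hasSum_half _).summable (auxT_bound ht hq hw)

lemma auxS_bound {t : ℕ} (ht : 30 ≤ t) {q w : ℂ} (hq : ‖q‖ ≤ 3 / 4) (hw : ‖w‖ ≤ 5 / 4) :
    ‖auxS t q w‖ ≤ 25 / 4 * ‖q‖ ^ (t + 2) := by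
  have := tsum_of_norm_bounded (hasSum_half _) (auxT_bound ht hq hw)
  unfold auxS
  linarith

lemma auxS_bound' {t : ℕ} (ht : 30 ≤ t) {q w : ℂ} (hq : ‖q‖ ≤ 3 / 4) (hw : ‖w‖ ≤ 5 / 4) :
    ‖auxS t q w‖ ≤ 1 / 500 := by
  have h1 := auxS_bound ht hq hw
  have h2 := pow_small ht hq
  have : 0 ≤ ‖q‖ ^ (t + 1) := by positivity
  have h3 : ‖q‖ ^ (t + 2) = ‖q‖ ^ (t + 1) * ‖q‖ := by ring
  rw [h3] at h1
  nlinarith [norm_nonneg q]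

/-- composition of the series with differentiable functions -/
lemma auxS_diff {t : ℕ} (ht : 30 ≤ t) {U : Set ℂ} (hU : IsOpen U) {f g : ℂ → ℂ}
    (hf : DifferentiableOn ℂ f U) (hg : DifferentiableOn ℂ g U)
    (hfb : ∀ z ∈ U, ‖f z‖ ≤ 3 / 4) (hgb : ∀ z ∈ U, ‖g z‖ ≤ 5 / 4) :
    DifferentiableOn ℂ (fun z => auxS t (f z) (g z)) U := by
  unfold auxS
  refine Complex.differentiableOn_tsum_of_summable_norm (u := fun j : ℕ => 1 * (1 / 2 : ℝ) ^ j)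
    (hasSum_half 1).summable ?_ hU ?_
  · intro j
    unfold auxT
    refine (((hg.neg.pow _).mul (hg.pow _)).mul hf).mul ?_
    refine DifferentiableOn.fun_finsetProd fun i _ => ?_
    unfold auxF
    refine (hf.pow _).div ((differentiableOn_const _).sub (hf.pow _)) ?_
    intro z hz h0
    have := den_bound ht (hfb z hz) i
    change 1 - f z ^ hp t (i + 2) = 0 at h0
    rw [h0, norm_zero] at this
    norm_num at this
  · intro j z hz
    refine (auxT_bound ht (hfb z hz) (hgb z hz) j).trans ?_
    have h2 := pow_small ht (hfb z hz)
    have hq := hfb z hz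
    have : 0 ≤ ‖f z‖ ^ (t + 1) := by positivity
    have h3 : ‖f z‖ ^ (t + 2) = ‖f z‖ ^ (t + 1) * ‖f z‖ := by ring
    gcongr
    rw [h3]
    nlinarith [norm_nonneg (f z)]

lemma auxS_lip {t : ℕ} (ht : 30 ≤ t) {w : ℂ} (hw : ‖w‖ ≤ 5 / 4) {p q : ℂ}
    (hp : ‖p‖ < 2 / 3) (hq : ‖q‖ < 2 / 3) :
    ‖auxS t q w - auxS t p w‖ ≤ 1 / 2 * ‖q - p‖ := by
  have hd : DifferentiableOn ℂ (fun z => auxS t z w) (Metric.ball 0 (3 / 4)) :=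
    auxS_diff ht Metric.isOpen_ball differentiableOn_id (differentiableOn_const _)
      (fun z hz => by simpa using (mem_ball_zero_iff.mp hz).le) (fun _ _ => hw)
  have hsub : ∀ x : ℂ, ‖x‖ < 2 / 3 → Metric.closedBall x (1 / 15) ⊆ Metric.ball 0 (3 / 4) := by
    intro x hx z hz
    rw [Metric.mem_closedBall, dist_eq_norm] at hz
    rw [mem_ball_zero_iff]
    have := norm_add_le (z - x) x
    rw [sub_add_cancel] at this
    linarith
  refine Convex.norm_image_sub_le_of_norm_deriv_le (f := fun z => auxS t z w)
    (s := Metric.ball 0 (2 / 3)) ?_ ?_ (convex_ball _ _) (by simpa using hp) (by simpa using hq)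
  · intro x hx
    refine hd.differentiableAt (Metric.isOpen_ball.mem_nhds ?_)
    exact hsub x (by simpa using hx) (Metric.mem_closedBall_self (by norm_num))
  · intro x hx
    have hs := hsub x (by simpa using hx)
    have := Complex.norm_deriv_le_of_forall_mem_sphere_norm_le (f := fun z => auxS t z w) (c := x)
      (R := 1 / 15) (C := 1 / 500) (by norm_num)
      ((hd.mono hs).diffContOnCl_ball (Set.Subset.refl _))
      (fun z hz => auxS_bound' ht
        (by simpa using (mem_ball_zero_iff.mp (hs (Metric.sphere_subset_closedBall hz))).le) hw)
    refine this.trans (by norm_num)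

lemma prod_split (f : ℕ → ℂ) (j : ℕ) :
    ∏ i ∈ Finset.Icc 1 (j + 2), f i = f 1 * ∏ i ∈ Finset.range (j + 1), f (i + 2) := by
  induction j with
  | zero => simp [Finset.prod_Icc_succ_top]
  | succ n ih =>
    rw [Finset.prod_Icc_succ_top (by omega), ih, Finset.prod_range_succ _ (n + 1)]
    ring

lemma DGF_eq {t : ℕ} (ht : 30 ≤ t) {q w : ℂ} (hq : ‖q‖ ≤ 3 / 4) (hw : ‖w‖ ≤ 5 / 4) :
    (1 - q) * DGF t q w = 1 - q * (1 + w) + auxS t q w := by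
  have h1 : (1 : ℂ) - q ≠ 0 := by
    intro h
    have : q = 1 := (sub_eq_zero.mp h).symm
    rw [this, norm_one] at hq
    norm_num at hq
  have hp1 : hp t 1 = 1 := by simp [hp]
  have hterm : ∀ j : ℕ, (-1 : ℂ) ^ (j + 2) * w ^ (j + 2) *
      ∏ i ∈ Finset.Icc 1 (j + 2), q ^ hp t i / (1 - q ^ hp t i) = (1 - q)⁻¹ * auxT t q w j := by
    intro j
    rw [prod_split (fun i => q ^ hp t i / (1 - q ^ hp t i))]
    unfold auxT auxF
    rw [hp1, neg_pow w]
    field_simp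
    ring
  have hs : Summable (fun j : ℕ => (-1 : ℂ) ^ j * w ^ j *
      ∏ i ∈ Finset.Icc 1 j, q ^ hp t i / (1 - q ^ hp t i)) := by
    rw [← summable_nat_add_iff 2]
    simp_rw [hterm]
    exact (auxT_summable ht hq hw).mul_left _
  unfold DGF
  rw [← hs.sum_add_tsum_nat_add 2]
  simp_rw [hterm]
  rw [tsum_mul_left]
  simp [Finset.sum_range_succ, hp1]
  unfold auxS
  field_simp
  ring

lemma DGF_conj (t : ℕ) (q w : ℂ) :
    DGF t ((starRingEnd ℂ) q) ((starRingEnd ℂ) w) = (starRingEnd ℂ) (DGF t q w) := by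
  unfold DGF
  rw [Complex.conj_tsum]
  refine tsum_congr fun j => ?_
  simp [map_prod]

lemma ball_facts {w : ℂ} (hw : ‖w - 1‖ < 1 / 4) : ‖w‖ ≤ 5 / 4 ∧ 7 / 4 ≤ ‖1 + w‖ := by
  constructor
  · have := norm_add_le (w - 1) 1
    rw [sub_add_cancel, norm_one] at this
    linarith
  · have := norm_sub_norm_le (2 : ℂ) (1 - w)
    rw [show (2 : ℂ) - (1 - w) = 1 + w by ring, norm_sub_rev 1 w] at this
    simp at this
    linarith

/-- fixed point iteration -/
def auxIter (t : ℕ) : ℕ → ℂ → ℂ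
  | 0 => fun _ => 0
  | n + 1 => fun w => (1 + auxS t (auxIter t n w) w) / (1 + w)

lemma auxIter_facts {t : ℕ} (ht : 30 ≤ t) (n : ℕ) :
    (∀ w ∈ Metric.ball (1 : ℂ) (1 / 4), ‖auxIter t n w‖ < 2 / 3) ∧
    DifferentiableOn ℂ (auxIter t n) (Metric.ball (1 : ℂ) (1 / 4)) := by
  induction n with
  | zero => exact ⟨fun w _ => by simp [auxIter], by unfold auxIter; exact differentiableOn_const _⟩
  | succ n ih =>
    constructor
    · intro w hw
      have hb := ball_facts (mem_ball_iff_norm.mp hw)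
      have h1 := auxS_bound' ht (q := auxIter t n w) (by linarith [ih.1 w hw]) hb.1
      have h2 := norm_add_le 1 (auxS t (auxIter t n w) w)
      rw [norm_one] at h2
      simp only [auxIter]
      rw [norm_div, div_lt_iff₀ (by linarith)]
      linarith
    · simp only [auxIter]
      have hd := auxS_diff ht Metric.isOpen_ball ih.2 differentiableOn_id
        (fun z hz => by linarith [ih.1 z hz])
        (fun z hz => (ball_facts (mem_ball_iff_norm.mp hz)).1)
      refine ((differentiableOn_const _).add hd).div
        ((differentiableOn_const _).add differentiableOn_id) ?_
      intro w hw h0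
      have hb := ball_facts (mem_ball_iff_norm.mp hw)
      change 1 + w = 0 at h0
      rw [h0, norm_zero] at hb
      linarith [hb.2]

lemma fix_diff {t : ℕ} (ht : 30 ≤ t) (q₀ : ℂ → ℂ)
    (h1 : ∀ w ∈ Metric.ball (1 : ℂ) (1 / 4), ‖q₀ w‖ < 2 / 3)
    (h2 : ∀ w ∈ Metric.ball (1 : ℂ) (1 / 4), q₀ w = (1 + auxS t (q₀ w) w) / (1 + w)) :
    DifferentiableOn ℂ q₀ (Metric.ball (1 : ℂ) (1 / 4)) := by
  have hb : ∀ n : ℕ, ∀ w ∈ Metric.ball (1 : ℂ) (1 / 4),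
      ‖q₀ w - auxIter t n w‖ ≤ (1 / 2) ^ n := by
    intro n w hw
    have hf := ball_facts (mem_ball_iff_norm.mp hw)
    induction n with
    | zero => simp [auxIter]; linarith [h1 w hw]
    | succ n ih =>
      have hl := auxS_lip ht hf.1 ((auxIter_facts ht n).1 w hw) (h1 w hw)
      have he : q₀ w - auxIter t (n + 1) w =
          (auxS t (q₀ w) w - auxS t (auxIter t n w) w) / (1 + w) := by
        conv_lhs => rw [h2 w hw]
        simp only [auxIter]
        ring
      rw [he, norm_div, div_le_iff₀ (by linarith), pow_succ]
      have : (0 : ℝ) < (1 / 2) ^ n := by positivity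
      nlinarith
  have hu : TendstoUniformlyOn (fun n => auxIter t n) q₀ atTop (Metric.ball (1 : ℂ) (1 / 4)) := by
    rw [Metric.tendstoUniformlyOn_iff]
    intro ε hε
    have := (tendsto_pow_atTop_nhds_zero_of_lt_one (r := (1 / 2 : ℝ)) (by norm_num)
      (by norm_num)).eventually (gt_mem_nhds hε)
    filter_upwards [this] with n hn w hw
    rw [dist_eq_norm]
    exact (hb n w hw).trans_lt hn
  exact hu.tendstoLocallyUniformlyOn.differentiableOn
    (Eventually.of_forall fun n => (auxIter_facts ht n).2) Metric.isOpen_ball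

lemma exp_near {z : ℂ} (hz : ‖z‖ < 1 / 5) : ‖Complex.exp z - 1‖ < 1 / 4 := by
  have h1 := Complex.norm_exp_sub_one_sub_id_le (x := z) (by linarith)
  have h2 := norm_add_le (Complex.exp z - 1 - z) z
  rw [sub_add_cancel] at h2
  nlinarith [norm_nonneg z]

/-- second derivative of the leading term -/
lemma lead_deriv {x : ℝ} (hx : 0 < Real.cos x) :
    HasDerivAt (fun y : ℝ => 1 / (2 + 2 * Real.cos y))
      (Real.sin x / (2 * (1 + Real.cos x) ^ 2)) x := by
  have h := ((Real.hasDerivAt_cos x).const_mul 2).const_add 2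
  have h0 : 2 + 2 * Real.cos x ≠ 0 := by positivity
  have := (hasDerivAt_const x (1 : ℝ)).div h h0
  convert! this using 1
  have : 1 + Real.cos x ≠ 0 := by positivity
  field_simp
  ring

lemma lead_deriv2 {x : ℝ} (hx : 0 < Real.cos x) :
    HasDerivAt (fun y : ℝ => Real.sin y / (2 * (1 + Real.cos y) ^ 2))
      ((2 - Real.cos x) / (2 * (1 + Real.cos x) ^ 2)) x := by
  have h := ((((Real.hasDerivAt_cos x).const_add 1).pow 2).const_mul 2)
  have h0 : 1 + Real.cos x ≠ 0 := by positivity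
  have := (Real.hasDerivAt_sin x).div h (by simp; exact h0)
  convert! this using 1
  have hs : Real.sin x ^ 2 = 1 - Real.cos x ^ 2 := Real.sin_sq x
  simp
  field_simp
  ring_nf
  rw [hs]
  ring

/-- second derivative of a real function which is a leading term plus a holomorphic remainder -/
lemma second_deriv_eq {F G G1 : ℝ → ℝ} {G2 : ℝ} {E : ℂ → ℂ} {φ : ℝ} {U : Set ℂ} (hU : IsOpen U)
    (hφ : (φ : ℂ) ∈ U) (hE : DifferentiableOn ℂ E U)
    (hF : ∀ ψ : ℝ, (ψ : ℂ) ∈ U → F ψ = G ψ + (E ψ).re)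
    (hG : ∀ ψ : ℝ, (ψ : ℂ) ∈ U → HasDerivAt G (G1 ψ) ψ)
    (hG1 : HasDerivAt G1 G2 φ) :
    iteratedDeriv 2 F φ = G2 + (iteratedDeriv 2 E φ).re := by
  have hV : IsOpen ((fun x : ℝ => (x : ℂ)) ⁻¹' U) := hU.preimage Complex.continuous_ofReal
  have hd1 : ∀ ψ : ℝ, (ψ : ℂ) ∈ U → deriv F ψ = G1 ψ + (deriv E ψ).re := by
    intro ψ hψ
    have he : F =ᶠ[nhds ψ] fun x => G x + (E x).re := by
      filter_upwards [hV.mem_nhds hψ] with x hx using hF x hx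
    rw [he.deriv_eq]
    exact ((hG ψ hψ).add
      ((hE.differentiableAt (hU.mem_nhds hψ)).hasDerivAt.real_of_complex)).deriv
  rw [iteratedDeriv_succ, iteratedDeriv_one, iteratedDeriv_succ, iteratedDeriv_one]
  have he : deriv F =ᶠ[nhds φ] fun x => G1 x + (deriv E x).re := by
    filter_upwards [hV.mem_nhds hφ] with x hx using hd1 x hx
  rw [he.deriv_eq]
  exact (hG1.add
    (((hE.deriv hU).differentiableAt (hU.mem_nhds hφ)).hasDerivAt.real_of_complex)).deriv

lemma key {t : ℕ} (ht : 30 ≤ t) (q₀ : ℂ → ℂ)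
    (h1 : ∀ w ∈ Metric.ball (1 : ℂ) (1 / 4), ‖q₀ w‖ < 2 / 3)
    (h2 : ∀ w ∈ Metric.ball (1 : ℂ) (1 / 4), q₀ w = (1 + auxS t (q₀ w) w) / (1 + w))
    (h3 : ∀ w ∈ Metric.ball (1 : ℂ) (1 / 4),
      q₀ ((starRingEnd ℂ) w) = (starRingEnd ℂ) (q₀ w))
    {φ : ℝ} (hφ : |φ| < 1 / 100) :
    |iteratedDeriv 2 (fun ψ : ℝ => ‖q₀ (Complex.exp (ψ * Complex.I))‖ ^ 2) φ -
      (2 - Real.cos φ) / (2 * (1 + Real.cos φ) ^ 2)| ≤ 111 * (2 / 3) ^ t := by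
  have hqd := fix_diff ht q₀ h1 h2
  have hr : ∀ w ∈ Metric.ball (1 : ℂ) (1 / 4), ‖q₀ w - 1 / (1 + w)‖ ≤ 8 / 5 * (2 / 3) ^ t := by
    intro w hw
    have hb := ball_facts (mem_ball_iff_norm.mp hw)
    have he : q₀ w - 1 / (1 + w) = auxS t (q₀ w) w / (1 + w) := by
      conv_lhs => rw [h2 w hw]
      ring
    have hS := auxS_bound ht (q := q₀ w) (by linarith [h1 w hw]) hb.1
    have hq : ‖q₀ w‖ ^ (t + 2) ≤ (2 / 3 : ℝ) ^ (t + 2) := by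
      gcongr; exact (h1 w hw).le
    rw [pow_add (2 / 3 : ℝ)] at hq
    rw [he, norm_div, div_le_iff₀ (by linarith)]
    have : (0 : ℝ) < (2 / 3) ^ t := by positivity
    nlinarith
  set U : Set ℂ := Metric.ball 0 (1 / 5) with hUdef
  have hI : ∀ z ∈ U, Complex.exp (z * Complex.I) ∈ Metric.ball (1 : ℂ) (1 / 4) := by
    intro z hz
    rw [mem_ball_iff_norm]
    exact exp_near (by simpa [hUdef] using hz)
  have hI' : ∀ z ∈ U, Complex.exp (-z * Complex.I) ∈ Metric.ball (1 : ℂ) (1 / 4) := by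
    intro z hz
    rw [mem_ball_iff_norm]
    exact exp_near (by simpa [hUdef] using hz)
  have hne : ∀ w ∈ Metric.ball (1 : ℂ) (1 / 4), 1 + w ≠ 0 := by
    intro w hw h0
    have hb := ball_facts (mem_ball_iff_norm.mp hw)
    rw [h0, norm_zero] at hb
    linarith [hb.2]
  set E : ℂ → ℂ := fun z => q₀ (Complex.exp (z * Complex.I)) * q₀ (Complex.exp (-z * Complex.I)) -
    1 / (1 + Complex.exp (z * Complex.I)) * (1 / (1 + Complex.exp (-z * Complex.I))) with hEdef
  have d1 : DifferentiableOn ℂ (fun z : ℂ => Complex.exp (z * Complex.I)) U := by fun_prop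
  have d2 : DifferentiableOn ℂ (fun z : ℂ => Complex.exp (-z * Complex.I)) U := by fun_prop
  have hEd : DifferentiableOn ℂ E U := by
    refine ((hqd.comp d1 hI).mul (hqd.comp d2 hI')).sub (DifferentiableOn.mul ?_ ?_)
    · exact (differentiableOn_const _).div ((differentiableOn_const _).add d1)
        (fun z hz => hne _ (hI z hz))
    · exact (differentiableOn_const _).div ((differentiableOn_const _).add d2)
        (fun z hz => hne _ (hI' z hz))
  have hEb : ∀ z ∈ U, ‖E z‖ ≤ 2 * (2 / 3) ^ t := by
    intro z hz
    have a1 := hr _ (hI z hz)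
    have a2 := hr _ (hI' z hz)
    have b1 := h1 _ (hI z hz)
    have c2 := (ball_facts (mem_ball_iff_norm.mp (hI' z hz))).2
    have c3 : ‖1 / (1 + Complex.exp (-z * Complex.I))‖ ≤ 4 / 7 := by
      rw [norm_div, norm_one, div_le_iff₀ (by linarith)]
      linarith
    have hpos : (0 : ℝ) < (2 / 3) ^ t := by positivity
    simp only [hEdef]
    generalize q₀ (Complex.exp (z * Complex.I)) = q at *
    generalize q₀ (Complex.exp (-z * Complex.I)) = q' at *
    generalize 1 / (1 + Complex.exp (z * Complex.I)) = a at *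
    generalize 1 / (1 + Complex.exp (-z * Complex.I)) = a' at *
    calc ‖q * q' - a * a'‖ = ‖q * (q' - a') + (q - a) * a'‖ := by ring_nf
      _ ≤ ‖q‖ * ‖q' - a'‖ + ‖q - a‖ * ‖a'‖ := by
        refine (norm_add_le _ _).trans ?_
        rw [norm_mul, norm_mul]
      _ ≤ 2 / 3 * (8 / 5 * (2 / 3) ^ t) + 8 / 5 * (2 / 3) ^ t * (4 / 7) := by gcongr
      _ ≤ 2 * (2 / 3) ^ t := by linarith
  have hcos : ∀ ψ : ℝ, (ψ : ℂ) ∈ U → 0 < Real.cos ψ := by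
    intro ψ hψ
    have hψ' : |ψ| < 1 / 5 := by simpa [hUdef] using hψ
    have := Real.one_sub_sq_div_two_le_cos (x := ψ)
    nlinarith [abs_nonneg ψ, sq_abs ψ]
  have hφU : (φ : ℂ) ∈ U := by
    simp [hUdef]; linarith
  have hF : ∀ ψ : ℝ, (ψ : ℂ) ∈ U → ‖q₀ (Complex.exp (ψ * Complex.I))‖ ^ 2 =
      1 / (2 + 2 * Real.cos ψ) + (E ψ).re := by
    intro ψ hψ
    have hc : Complex.exp (-ψ * Complex.I) = (starRingEnd ℂ) (Complex.exp (ψ * Complex.I)) := by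
      rw [← Complex.exp_conj]; simp
    have e1 : q₀ (Complex.exp (ψ * Complex.I)) * q₀ (Complex.exp (-ψ * Complex.I)) =
        ((‖q₀ (Complex.exp (ψ * Complex.I))‖ ^ 2 : ℝ) : ℂ) := by
      rw [hc, h3 _ (hI _ hψ), Complex.mul_conj, Complex.normSq_eq_norm_sq]
    have e2 : 1 / (1 + Complex.exp (ψ * Complex.I)) * (1 / (1 + Complex.exp (-ψ * Complex.I))) =
        ((1 / (2 + 2 * Real.cos ψ) : ℝ) : ℂ) := by
      rw [div_mul_div_comm, one_mul]
      push_cast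
      congr 1
      rw [Complex.cos]
      have : Complex.exp (ψ * Complex.I) * Complex.exp (-ψ * Complex.I) = 1 := by
        rw [← Complex.exp_add]; simp
      linear_combination this
    simp only [hEdef]
    rw [e1, e2, ← Complex.ofReal_sub, Complex.ofReal_re]
    ring
  rw [second_deriv_eq Metric.isOpen_ball hφU hEd hF (fun ψ hψ => lead_deriv (hcos ψ hψ))
    (lead_deriv2 (hcos φ hφU)), add_sub_cancel_left]
  refine (Complex.abs_re_le_norm _).trans ?_
  have hsub : Metric.closedBall (φ : ℂ) (19 / 100) ⊆ U := by
    intro z hz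
    rw [Metric.mem_closedBall, dist_eq_norm] at hz
    rw [hUdef, mem_ball_zero_iff]
    have := norm_add_le (z - φ) φ
    rw [sub_add_cancel, Complex.norm_real, Real.norm_eq_abs] at this
    linarith
  have := Complex.norm_iteratedDeriv_le_of_forall_mem_sphere_norm_le (f := E) (c := φ)
    (R := 19 / 100) (C := 2 * (2 / 3) ^ t) 2 (by norm_num)
    ((hEd.mono hsub).diffContOnCl_ball (Set.Subset.refl _))
    (fun z hz => hEb z (hsub (Metric.sphere_subset_closedBall hz)))
  refine this.trans ?_
  have hpos : (0 : ℝ) < (2 / 3) ^ t := by positivity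
  rw [div_le_iff₀ (by norm_num)]
  norm_num [Nat.factorial]
  nlinarith


/-- Convexity in the central region: for `t ≥ 30` and the implicitly
defined root `q₀(w)` (`D(q₀(w),w) = 0`, `|q₀(w)| < 2/3`), the second derivative of
`φ ↦ |q₀(e^{iφ})|²` is strictly positive for `|φ| ≤ √(97/96)·π·2^{−t/2}`; at `φ = 0` it
equals `1/8 + ε·144/2^{t/2}` with `|ε| ≤ 1`, hence exceeds `0.1206`. -/
theorem second_derivative_positive_central_region (t : ℕ) (ht : 30 ≤ t)
    (q₀ : ℂ → ℂ)
    (hroot : ∀ w ∈ Metric.closedBall (1 : ℂ) (1/2 - 5 * (2/3 : ℝ) ^ t),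
      ‖q₀ w‖ < 2/3 ∧ DGF t (q₀ w) w = 0)
    (huniq : ∀ w ∈ Metric.closedBall (1 : ℂ) (1/2 - 5 * (2/3 : ℝ) ^ t),
      ∀ q : ℂ, ‖q‖ < 2/3 → DGF t q w = 0 → q = q₀ w) :
    (∀ φ : ℝ, |φ| ≤ Real.sqrt (97/96) * Real.pi * 2 ^ (-(t : ℝ)/2) →
      0 < iteratedDeriv 2 (fun ψ : ℝ => ‖q₀ (Complex.exp (ψ * Complex.I))‖ ^ 2) φ) ∧
    (∃ ε : ℝ, |ε| ≤ 1 ∧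
      iteratedDeriv 2 (fun ψ : ℝ => ‖q₀ (Complex.exp (ψ * Complex.I))‖ ^ 2) 0
        = 1/8 + ε * 144 / 2 ^ ((t : ℝ)/2)) ∧
    0.1206 < iteratedDeriv 2 (fun ψ : ℝ => ‖q₀ (Complex.exp (ψ * Complex.I))‖ ^ 2) 0 := by
  have hpow : (2 / 3 : ℝ) ^ t ≤ 1 / 100000 := by
    calc (2 / 3 : ℝ) ^ t ≤ (2 / 3 : ℝ) ^ 30 :=
          pow_le_pow_of_le_one (by norm_num) (by norm_num) ht
      _ ≤ _ := by norm_num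
  have hsub : Metric.ball (1 : ℂ) (1 / 4) ⊆
      Metric.closedBall (1 : ℂ) (1/2 - 5 * (2/3 : ℝ) ^ t) :=
    Metric.ball_subset_closedBall.trans (Metric.closedBall_subset_closedBall (by linarith))
  have h1 : ∀ w ∈ Metric.ball (1 : ℂ) (1 / 4), ‖q₀ w‖ < 2 / 3 :=
    fun w hw => (hroot w (hsub hw)).1
  have h2 : ∀ w ∈ Metric.ball (1 : ℂ) (1 / 4), q₀ w = (1 + auxS t (q₀ w) w) / (1 + w) := by
    intro w hw
    have hb := ball_facts (mem_ball_iff_norm.mp hw)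
    have h := DGF_eq ht (q := q₀ w) (by linarith [h1 w hw]) hb.1
    rw [(hroot w (hsub hw)).2, mul_zero] at h
    have hne : 1 + w ≠ 0 := by
      intro h0
      rw [h0, norm_zero] at hb
      linarith [hb.2]
    rw [eq_div_iff hne]
    linear_combination h
  have h3 : ∀ w ∈ Metric.ball (1 : ℂ) (1 / 4),
      q₀ ((starRingEnd ℂ) w) = (starRingEnd ℂ) (q₀ w) := by
    intro w hw
    have hw' : (starRingEnd ℂ) w ∈ Metric.ball (1 : ℂ) (1 / 4) := by
      rw [mem_ball_iff_norm] at hw ⊢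
      rw [← Complex.norm_conj]
      simpa using hw
    symm
    refine huniq _ (hsub hw') _ ?_ ?_
    · rw [Complex.norm_conj]; exact h1 w hw
    · rw [DGF_conj, (hroot w (hsub hw)).2, map_zero]
  have hkey := fun (φ : ℝ) (hφ : |φ| < 1 / 100) => key ht q₀ h1 h2 h3 hφ
  set s : ℝ := 2 ^ ((t : ℝ) / 2) with hs
  have hs0 : 0 < s := by positivity
  have hss : s ^ 2 = 2 ^ t := by
    rw [hs, ← Real.rpow_natCast, ← Real.rpow_mul (by norm_num), ← Real.rpow_natCast]
    congr 1
    push_cast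
    ring
  have hs15 : 32768 ≤ s := by
    have : (2 : ℝ) ^ 30 ≤ 2 ^ t := pow_le_pow_right₀ (by norm_num) ht
    rw [← hss] at this
    nlinarith
  have hrel : (2 / 3 : ℝ) ^ t * s ≤ 1 := by
    have : ((2 / 3 : ℝ) ^ t * s) ^ 2 ≤ 1 := by
      rw [mul_pow, hss, ← pow_mul, mul_comm t 2, pow_mul, ← mul_pow]
      exact pow_le_one₀ (by norm_num) (by norm_num)
    nlinarith
  have h0 := hkey 0 (by norm_num)
  rw [Real.cos_zero] at h0
  norm_num at h0
  refine ⟨?_, ?_, ?_⟩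
  · intro φ hφ
    have hφ' : |φ| < 1 / 100 := by
      refine lt_of_le_of_lt hφ ?_
      have e1 : (2 : ℝ) ^ (-(t : ℝ) / 2) = s⁻¹ := by
        rw [hs, ← Real.rpow_neg (by norm_num)]
        congr 1
        ring
      have e2 : Real.sqrt (97 / 96) ≤ 2 := by
        rw [Real.sqrt_le_left (by norm_num)]
        norm_num
      rw [e1, ← div_eq_mul_inv, div_lt_iff₀ hs0]
      have := Real.pi_le_four
      have := Real.pi_pos
      nlinarith [Real.sqrt_nonneg (97 / 96)]
    have hk := abs_le.mp (hkey φ hφ')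
    have hc : 0 < Real.cos φ := by
      have := Real.one_sub_sq_div_two_le_cos (x := φ)
      nlinarith [abs_nonneg φ, sq_abs φ]
    have hc1 := Real.cos_le_one φ
    have : 1 / 8 ≤ (2 - Real.cos φ) / (2 * (1 + Real.cos φ) ^ 2) := by
      rw [le_div_iff₀ (by positivity)]
      nlinarith
    linarith [hk.1]
  · refine ⟨(iteratedDeriv 2 (fun ψ : ℝ => ‖q₀ (Complex.exp (ψ * Complex.I))‖ ^ 2) 0 - 1 / 8)
      * s / 144, ?_, ?_⟩
    · rw [abs_div, abs_mul, abs_of_pos hs0, abs_of_pos (by norm_num : (0 : ℝ) < 144),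
        div_le_one (by norm_num)]
      nlinarith
    · generalize iteratedDeriv 2 (fun ψ : ℝ => ‖q₀ (Complex.exp (ψ * Complex.I))‖ ^ 2) 0 = X
      field_simp
      ring
  · have := (abs_le.mp h0).1
    norm_num at this ⊢
    linarith

end
end
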